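/- arXiv:1511.00065 — 3 statements merged into one kernel-verified Lean document; each statement's English description precedes it below -/
import Mathlib

section
/- (Solvability of the boundary-value problem in the biexponential case) Assume ḡ_λ(k) ≠ 0 on a neighborhood of k∞, and suppose k∞ > 0 satisfies f′(k∞) ≠ ḡ_λ(k∞). Then there exist an open neighborhood of k∞ and functions V, W defined on it, with V of class C² and W of class C¹, which satisfy the equations (35) and (36) together with the boundary conditions (37) and (38). -/
open MeasureTheory Filter Set

noncomputable def pd1 (u : ℝ → ℝ → ℝ) (c k : ℝ) : ℝ := deriv (fun x => u x k) c
noncomputable def pd2 (u : ℝ → ℝ → ℝ) (c k : ℝ) : ℝ := deriv (fun y => u c y) k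
noncomputable def pd11 (u : ℝ → ℝ → ℝ) (c k : ℝ) : ℝ := deriv (fun x => pd1 u x k) c

/-- The function `ḡ_λ(k)` of the paper. -/
noncomputable def gbar (f : ℝ → ℝ) (u U : ℝ → ℝ → ℝ) (lam δ₁ δ₂ : ℝ) (k : ℝ) : ℝ :=
  (lam * δ₁ * pd1 u (f k) k + (1 - lam) * δ₂ * pd1 U (f k) k) /
    (lam * pd1 u (f k) k + (1 - lam) * pd1 U (f k) k) -
  (lam * pd2 u (f k) k + (1 - lam) * pd2 U (f k) k) /
    (lam * pd1 u (f k) k + (1 - lam) * pd1 U (f k) k)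

def Eq35 (f : ℝ → ℝ) (u U : ℝ → ℝ → ℝ) (φ : ℝ → ℝ → ℝ) (lam a b : ℝ)
    (V W : ℝ → ℝ) (k : ℝ) : Prop :=
  (f k - φ (deriv V k) k) * deriv V k + u (φ (deriv V k) k) k +
    (1 - lam) / lam * U (φ (deriv V k) k) k = a * V k + b * W k

def Eq36 (f : ℝ → ℝ) (u U : ℝ → ℝ → ℝ) (φ : ℝ → ℝ → ℝ) (lam a b : ℝ)
    (V W : ℝ → ℝ) (k : ℝ) : Prop :=
  (f k - φ (deriv V k) k) * deriv W k + u (φ (deriv V k) k) k -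
    (1 - lam) / lam * U (φ (deriv V k) k) k = b * V k + a * W k

open Topology

/-- A differentiable function starting below `K` that does not increase while above `K` stays
below `K`. -/
theorem le_of_deriv_nonpos_above {z z' : ℝ → ℝ} {a c K : ℝ} (ha : z a ≤ K)
    (hz : ∀ t ∈ Icc a c, HasDerivAt z (z' t) t)
    (hz' : ∀ t ∈ Icc a c, K < z t → z' t ≤ 0) : ∀ t ∈ Icc a c, z t ≤ K := by
  have key : ∀ ε > 0, ∀ t ∈ Icc a c, z t ≤ (K + ε) + ε * (t - a) := by
    intro ε hε
    refine image_le_of_deriv_right_lt_deriv_boundary' (f' := z') (B' := fun _ => ε)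
      (fun t ht => (hz t ht).continuousAt.continuousWithinAt)
      (fun t ht => (hz t (Ico_subset_Icc_self ht)).hasDerivWithinAt) (by linarith)
      (by fun_prop) (fun t _ => ?_) (fun t ht h => ?_)
    · have : HasDerivAt (fun t => K + ε + ε * (t - a)) (ε * 1) t :=
        (((hasDerivAt_id t).sub_const a).const_mul ε).const_add _
      simpa using this.hasDerivWithinAt
    · have h0 : 0 ≤ ε * (t - a) := mul_nonneg hε.le (by linarith [ht.1])
      exact (hz' t (Ico_subset_Icc_self ht) (by linarith)).trans_lt hε
  intro t ht
  by_contra! h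
  have hp : 0 < 2 * (1 + (t - a)) := by linarith [ht.1]
  have := key ((z t - K) / (2 * (1 + (t - a)))) (div_pos (by linarith) hp) t ht
  have e : (z t - K) / (2 * (1 + (t - a))) * (2 * (1 + (t - a))) = z t - K :=
    div_mul_cancel₀ _ hp.ne'
  nlinarith

/-- A quantity relaxing at rate at least `κ₀ / m` towards a forcing of size `A / m` stays
bounded by `A / κ₀`. -/
theorem abs_le_of_relaxation {z z' : ℝ → ℝ} {a c K : ℝ} (ha : z a = 0) (hK : 0 ≤ K)
    (hz : ∀ t ∈ Icc a c, HasDerivAt z (z' t) t)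
    (h : ∀ t ∈ Icc a c, ∃ m > 0, ∃ κ₀ > 0, ∃ κ ≤ -κ₀, ∃ A, |A| ≤ κ₀ * K ∧
      m * z' t = κ * z t + A) :
    ∀ t ∈ Icc a c, |z t| ≤ K := by
  intro t ht
  refine abs_le.2 ⟨?_, ?_⟩
  · have := le_of_deriv_nonpos_above (z := fun t => -z t) (z' := fun t => -z' t) (K := K)
      (by simpa [ha] using hK) (fun t ht => (hz t ht).neg) (fun s hs hKs => ?_) t ht
    · linarith
    obtain ⟨m, hm, κ₀, hκ₀, κ, hκ, A, hA, e⟩ := h s hs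
    have hA := abs_le.1 hA
    have : 0 ≤ m * z' s := by
      rw [e]; nlinarith [mul_nonneg (sub_nonneg.2 hκ) (hK.trans hKs.le)]
    linarith [nonneg_of_mul_nonneg_right this hm]
  · refine le_of_deriv_nonpos_above (by simpa [ha] using hK) hz (fun s hs hKs => ?_) t ht
    obtain ⟨m, hm, κ₀, hκ₀, κ, hκ, A, hA, e⟩ := h s hs
    have hA := abs_le.1 hA
    have : 0 ≤ m * (-z' s) := by
      rw [mul_neg, e]; nlinarith [mul_nonneg (sub_nonneg.2 hκ) (hK.trans hKs.le)]
    linarith [nonneg_of_mul_nonneg_right this hm]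

/-- Global solvability of a scalar linear differential equation. -/
theorem exists_hasDerivAt_linear {α β : ℝ → ℝ} (hα : Continuous α) (hβ : Continuous β) (a : ℝ) :
    ∃ y : ℝ → ℝ, y a = 0 ∧ ∀ t, HasDerivAt y (α t * y t + β t) t := by
  set E : ℝ → ℝ := fun t => Real.exp (∫ s in a..t, α s)
  have hE : ∀ t, HasDerivAt E (E t * α t) t := fun t =>
    (intervalIntegral.integral_hasDerivAt_right (hα.intervalIntegrable _ _)
      (hα.stronglyMeasurableAtFilter _ _) hα.continuousAt).exp
  have hEc : Continuous E := continuous_iff_continuousAt.2 fun t => (hE t).continuousAt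
  have hE0 : ∀ t, E t ≠ 0 := fun t => (Real.exp_pos _).ne'
  have hc : Continuous fun s => β s / E s := hβ.div hEc hE0
  refine ⟨fun t => E t * ∫ s in a..t, β s / E s, by simp, fun t => ?_⟩
  have h := (hE t).mul (intervalIntegral.integral_hasDerivAt_right (hc.intervalIntegrable a t)
      (hc.stronglyMeasurableAtFilter _ _) hc.continuousAt)
  refine h.congr_deriv ?_
  have := hE0 t
  field_simp

theorem abs_sqrt_add_sq_sub_le (x₁ x₂ s₁ s₂ : ℝ) :
    |√(x₁ ^ 2 + s₁ ^ 2) - √(x₂ ^ 2 + s₂ ^ 2)| ≤ |x₁ - x₂| + |s₁ - s₂| := by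
  have key : ∀ x₁ x₂ s₁ s₂ : ℝ,
      √(x₁ ^ 2 + s₁ ^ 2) ≤ √(x₂ ^ 2 + s₂ ^ 2) + (|x₁ - x₂| + |s₁ - s₂|) := by
    intro x₁ x₂ s₁ s₂
    have h0 := Real.sqrt_nonneg (x₂ ^ 2 + s₂ ^ 2)
    have hs := Real.sq_sqrt (show 0 ≤ x₂ ^ 2 + s₂ ^ 2 by positivity)
    have hx : |x₂| ≤ √(x₂ ^ 2 + s₂ ^ 2) := Real.abs_le_sqrt (by nlinarith)
    have hs' : |s₂| ≤ √(x₂ ^ 2 + s₂ ^ 2) := Real.abs_le_sqrt (by nlinarith)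
    refine Real.sqrt_le_iff.2 ⟨by positivity, ?_⟩
    have e1 : x₁ ^ 2 ≤ x₂ ^ 2 + 2 * |x₂| * |x₁ - x₂| + |x₁ - x₂| ^ 2 := by
      have := le_abs_self (x₂ * (x₁ - x₂))
      rw [abs_mul] at this
      rw [sq_abs]
      nlinarith
    have e2 : s₁ ^ 2 ≤ s₂ ^ 2 + 2 * |s₂| * |s₁ - s₂| + |s₁ - s₂| ^ 2 := by
      have := le_abs_self (s₂ * (s₁ - s₂))
      rw [abs_mul] at this
      rw [sq_abs]
      nlinarith
    have e3 := mul_le_mul_of_nonneg_right hx (abs_nonneg (x₁ - x₂))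
    have e4 := mul_le_mul_of_nonneg_right hs' (abs_nonneg (s₁ - s₂))
    have e5 := mul_nonneg (abs_nonneg (x₁ - x₂)) (abs_nonneg (s₁ - s₂))
    nlinarith
  refine abs_sub_le_iff.2 ⟨by linarith [key x₁ x₂ s₁ s₂], ?_⟩
  have := key x₂ x₁ s₂ s₁
  rw [abs_sub_comm x₂, abs_sub_comm s₂] at this
  linarith

/-- Size of the solution of the regularized singular linear equation. -/
theorem abs_le_mul_sqrt_of_singular {a c κ₀ B s : ℝ} {x x' y y' κ R : ℝ → ℝ} (hs : 0 < s)
    (hκ₀ : 0 < κ₀) (hB : 0 ≤ B) (hx : ∀ t ∈ Icc a c, HasDerivAt x (x' t) t)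
    (hxx : ∀ t ∈ Icc a c, |x t * x' t| ≤ κ₀ / 2)
    (hy : ∀ t ∈ Icc a c, HasDerivAt y (y' t) t) (hya : y a = 0)
    (hκ : ∀ t ∈ Icc a c, κ t ≤ -κ₀) (hR : ∀ t ∈ Icc a c, |R t| ≤ B)
    (h : ∀ t ∈ Icc a c, (x t ^ 2 + s ^ 2) * y' t = κ t * y t + x t * R t) :
    ∀ t ∈ Icc a c, |y t| ≤ 2 * B / κ₀ * √(x t ^ 2 + s ^ 2) := by
  have hpos : ∀ t, 0 < x t ^ 2 + s ^ 2 := fun t => by positivity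
  have hr : ∀ t, 0 < √(x t ^ 2 + s ^ 2) := fun t => Real.sqrt_pos.2 (hpos t)
  have key := abs_le_of_relaxation (z := fun t => y t / √(x t ^ 2 + s ^ 2)) (a := a) (c := c)
    (K := 2 * B / κ₀) (by simp [hya]) (by positivity)
    (fun t ht => (hy t ht).div
      ((((hx t ht).pow 2).add_const (s ^ 2)).sqrt (hpos t).ne') (hr t).ne')
    (fun t ht => by
      refine ⟨x t ^ 2 + s ^ 2, hpos t, κ₀ / 2, by positivity, κ t - x t * x' t, ?_,
        x t / √(x t ^ 2 + s ^ 2) * R t, ?_, ?_⟩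
      · have := (abs_le.1 (hxx t ht)).1
        linarith [hκ t ht]
      · have h1 : |x t / √(x t ^ 2 + s ^ 2)| ≤ 1 := by
          rw [abs_div, abs_of_pos (hr t), div_le_one (hr t)]
          exact Real.abs_le_sqrt (by nlinarith)
        rw [abs_mul, show κ₀ / 2 * (2 * B / κ₀) = B by field_simp]
        calc _ ≤ 1 * B := mul_le_mul h1 (hR t ht) (abs_nonneg _) zero_le_one
          _ = B := one_mul B
      · have e := h t ht
        have e2 := Real.sq_sqrt (hpos t).le
        have e3 := (hr t).ne'
        simp only [Pi.pow_apply]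
        set r := √(x t ^ 2 + s ^ 2)
        rw [← e2] at e ⊢
        field_simp
        simp only [Nat.cast_ofNat, Nat.add_one_sub_one, pow_one]
        linear_combination 2 * e)
  intro t ht
  have := key t ht
  rwa [abs_div, abs_of_pos (hr t), div_le_iff₀ (hr t)] at this

/-- Dependence on the data of the solution of the regularized singular linear equation. -/
theorem abs_sub_le_of_singular {a c κ₀ B K Q d s₁ s₂ : ℝ}
    {x₁ x₂ y₁ y₂ y₁' y₂' κ₁ κ₂ F₁ F₂ : ℝ → ℝ}
    (hs₁ : 0 < s₁) (hs₂ : 0 < s₂) (hκ₀ : 0 < κ₀) (hB : 0 ≤ B) (hK : 0 ≤ K) (hQ : 0 ≤ Q)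
    (hd : 0 ≤ d)
    (hy₁ : ∀ t ∈ Icc a c, HasDerivAt y₁ (y₁' t) t) (hy₂ : ∀ t ∈ Icc a c, HasDerivAt y₂ (y₂' t) t)
    (ha₁ : y₁ a = 0) (ha₂ : y₂ a = 0)
    (hκ₁ : ∀ t ∈ Icc a c, κ₁ t ≤ -κ₀) (hκ₂ : ∀ t ∈ Icc a c, κ₂ t ≤ -κ₀)
    (hκB₁ : ∀ t ∈ Icc a c, |κ₁ t| ≤ B) (hκB₂ : ∀ t ∈ Icc a c, |κ₂ t| ≤ B)
    (hF₁ : ∀ t ∈ Icc a c, |F₁ t| ≤ B * √(x₁ t ^ 2 + s₁ ^ 2))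
    (hF₂ : ∀ t ∈ Icc a c, |F₂ t| ≤ B * √(x₂ t ^ 2 + s₂ ^ 2))
    (hK₁ : ∀ t ∈ Icc a c, |y₁ t| ≤ K * √(x₁ t ^ 2 + s₁ ^ 2))
    (hK₂ : ∀ t ∈ Icc a c, |y₂ t| ≤ K * √(x₂ t ^ 2 + s₂ ^ 2))
    (hQ₁ : ∀ t ∈ Icc a c, |κ₁ t - κ₂ t| * |y₁ t| + |F₁ t - F₂ t| ≤ Q)
    (hQ₂ : ∀ t ∈ Icc a c, |κ₁ t - κ₂ t| * |y₂ t| + |F₁ t - F₂ t| ≤ Q)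
    (hrd : ∀ t ∈ Icc a c, |√(x₁ t ^ 2 + s₁ ^ 2) - √(x₂ t ^ 2 + s₂ ^ 2)| ≤ d)
    (h₁ : ∀ t ∈ Icc a c, (x₁ t ^ 2 + s₁ ^ 2) * y₁' t = κ₁ t * y₁ t + F₁ t)
    (h₂ : ∀ t ∈ Icc a c, (x₂ t ^ 2 + s₂ ^ 2) * y₂' t = κ₂ t * y₂ t + F₂ t) :
    ∀ t ∈ Icc a c, |y₁ t - y₂ t| ≤ (Q + 2 * (B * (K + 1)) * d) / κ₀ := by
  have hder : ∀ r m y' κ y F : ℝ, 0 < r → r ^ 2 = m → m * y' = κ * y + F → |κ| ≤ B →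
      |F| ≤ B * r → |y| ≤ K * r → r * |y'| ≤ B * (K + 1) := by
    intro r m y' κ y F hr hm e hκ hF hy
    have h1 : |m * y'| ≤ B * (K * r) + B * r := by
      rw [e]
      refine (abs_add_le _ _).trans (add_le_add ?_ hF)
      rw [abs_mul]
      exact mul_le_mul hκ hy (abs_nonneg _) hB
    rw [← hm, abs_mul, abs_of_pos (by positivity)] at h1
    refine le_of_mul_le_mul_left (a := r) ?_ hr
    nlinarith
  have hdiff : ∀ r₁ r₂ y' : ℝ, 0 < r₁ → r₁ ≤ r₂ → |r₁ - r₂| ≤ d → r₂ * |y'| ≤ B * (K + 1) →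
      |(r₁ ^ 2 - r₂ ^ 2) * y'| ≤ 2 * (B * (K + 1)) * d := by
    intro r₁ r₂ y' h1 h12 hd h
    have : |(r₁ ^ 2 - r₂ ^ 2) * y'| = |r₁ - r₂| * ((r₁ + r₂) * |y'|) := by
      rw [show (r₁ ^ 2 - r₂ ^ 2) * y' = (r₁ - r₂) * ((r₁ + r₂) * y') by ring, abs_mul, abs_mul,
        abs_of_pos (by linarith : 0 < r₁ + r₂)]
    rw [this]
    calc _ ≤ d * (2 * (B * (K + 1))) := by
          refine mul_le_mul hd ?_ (mul_nonneg (by linarith) (abs_nonneg _)) (by linarith [abs_nonneg (r₁ - r₂)])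
          nlinarith [abs_nonneg y']
      _ = _ := by ring
  refine abs_le_of_relaxation (by simp [ha₁, ha₂]) (by positivity)
    (fun t ht => (hy₁ t ht).sub (hy₂ t ht)) (fun t ht => ?_)
  have p₁ : 0 < x₁ t ^ 2 + s₁ ^ 2 := by positivity
  have p₂ : 0 < x₂ t ^ 2 + s₂ ^ 2 := by positivity
  have q₁ := Real.sqrt_pos.2 p₁
  have q₂ := Real.sqrt_pos.2 p₂
  have d₁ := hder _ _ _ _ _ _ q₁ (Real.sq_sqrt p₁.le) (h₁ t ht) (hκB₁ t ht) (hF₁ t ht) (hK₁ t ht)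
  have d₂ := hder _ _ _ _ _ _ q₂ (Real.sq_sqrt p₂.le) (h₂ t ht) (hκB₂ t ht) (hF₂ t ht) (hK₂ t ht)
  have e₁ := h₁ t ht
  have e₂ := h₂ t ht
  have hcancel : κ₀ * ((Q + 2 * (B * (K + 1)) * d) / κ₀) = Q + 2 * (B * (K + 1)) * d := by
    field_simp
  rcases le_total √(x₁ t ^ 2 + s₁ ^ 2) √(x₂ t ^ 2 + s₂ ^ 2) with hle | hle
  · have hb := hdiff _ _ _ q₁ hle (hrd t ht) d₂
    rw [Real.sq_sqrt p₁.le, Real.sq_sqrt p₂.le] at hb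
    refine ⟨_, p₁, κ₀, hκ₀, κ₁ t, hκ₁ t ht, (κ₁ t - κ₂ t) * y₂ t + (F₁ t - F₂ t) -
      ((x₁ t ^ 2 + s₁ ^ 2) - (x₂ t ^ 2 + s₂ ^ 2)) * y₂' t, ?_, ?_⟩
    · rw [hcancel]
      refine (abs_sub _ _).trans (add_le_add ((abs_add_le _ _).trans ?_) hb)
      rw [abs_mul]
      exact hQ₂ t ht
    · linear_combination e₁ - e₂
  · have hb := hdiff _ _ _ q₂ hle (by rw [abs_sub_comm]; exact hrd t ht) d₁
    rw [Real.sq_sqrt p₁.le, Real.sq_sqrt p₂.le] at hb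
    refine ⟨_, p₂, κ₀, hκ₀, κ₂ t, hκ₂ t ht, (κ₁ t - κ₂ t) * y₁ t + (F₁ t - F₂ t) +
      ((x₂ t ^ 2 + s₂ ^ 2) - (x₁ t ^ 2 + s₁ ^ 2)) * y₁' t, ?_, ?_⟩
    · rw [hcancel]
      refine (abs_add_le _ _).trans (add_le_add ((abs_add_le _ _).trans ?_) hb)
      rw [abs_mul]
      exact hQ₁ t ht
    · linear_combination e₁ - e₂

/-- A sequence of continuous functions on `[-η, η]` with geometrically decaying increments
converges, jointly in the index and the point, to a continuous function. -/
theorem exists_tendsto_prod_of_geometric {z : ℕ → ℝ → ℝ} {A η : ℝ} (hzc : ∀ n, Continuous (z n))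
    (hz : ∀ n, ∀ k ∈ Icc (-η) η, |z (n + 1) k - z n k| ≤ A * (3 / 4) ^ n) :
    ∃ Z : ℝ → ℝ, ∀ k ∈ Ioo (-η) η, ContinuousAt Z k ∧
      Tendsto (fun p : ℕ × ℝ => z p.1 p.2) (atTop ×ˢ 𝓝 k) (𝓝 (Z k)) := by
  have hex : ∀ k, ∃ Zk, k ∈ Icc (-η) η → Tendsto (fun n => z n k) atTop (𝓝 Zk) := by
    intro k
    by_cases hk : k ∈ Icc (-η) η
    · obtain ⟨l, hl⟩ := cauchySeq_tendsto_of_complete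
        (cauchySeq_of_le_geometric (f := fun n => z n k) (3 / 4) A (by norm_num)
          (fun n => by rw [dist_comm, Real.dist_eq]; exact hz n k hk))
      exact ⟨l, fun _ => hl⟩
    · exact ⟨0, fun h => absurd h hk⟩
  choose Z hZ using hex
  have hu : TendstoUniformlyOn z Z atTop (Icc (-η) η) := by
    refine Metric.tendstoUniformlyOn_iff.2 fun ε hε => ?_
    have h0 : Tendsto (fun n : ℕ => A * (3 / 4 : ℝ) ^ n / (1 - 3 / 4)) atTop (𝓝 0) := by
      have := ((tendsto_pow_atTop_nhds_zero_of_lt_one (r := (3 / 4 : ℝ)) (by norm_num)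
        (by norm_num)).const_mul A).div_const (1 - 3 / 4)
      simpa using this
    filter_upwards [h0.eventually (gt_mem_nhds hε)] with n hn k hk
    rw [dist_comm]
    exact (dist_le_of_le_geometric_of_tendsto (f := fun n => z n k) (3 / 4) A (by norm_num)
          (fun n => by rw [dist_comm, Real.dist_eq]; exact hz n k hk) (hZ k hk) n).trans_lt hn
  have hZc : ContinuousOn Z (Icc (-η) η) :=
    hu.continuousOn (Frequently.of_forall fun n => (hzc n).continuousOn)
  refine ⟨Z, fun k hk => ?_⟩
  have hnhds : Icc (-η) η ∈ 𝓝 k := Icc_mem_nhds hk.1 hk.2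
  have hZk := hZc.continuousAt hnhds
  refine ⟨hZk, ?_⟩
  rw [tendstoUniformlyOn_iff_tendstoUniformlyOnFilter] at hu
  have hu' := hu.mono_right (le_principal_iff.2 hnhds)
  refine Metric.tendsto_nhds.2 fun ε hε => ?_
  filter_upwards [Metric.tendstoUniformlyOnFilter_iff.1 hu' (ε / 2) (half_pos hε),
    (Metric.tendsto_nhds.1 hZk (ε / 2) (half_pos hε)).prod_inr atTop] with p hp1 hp2
  rw [dist_comm] at hp1
  exact (dist_triangle _ _ _).trans_lt (by linarith)

/-- The limit of differentiable functions is differentiable if the derivatives converge jointly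
in the index and the point to a continuous function. -/
theorem hasDerivAt_of_tendsto_prod {z z' : ℕ → ℝ → ℝ} {Z Z' : ℝ → ℝ} {k : ℝ} {s : Set ℝ}
    (hs : IsOpen s) (hk : k ∈ s) (hz : ∀ n k, HasDerivAt (z n) (z' n k) k)
    (hZc : ContinuousAt Z' k)
    (hzZ : Tendsto (fun p : ℕ × ℝ => z' p.1 p.2) (atTop ×ˢ 𝓝 k) (𝓝 (Z' k)))
    (hpt : ∀ k ∈ s, Tendsto (fun n => z n k) atTop (𝓝 (Z k))) : HasDerivAt Z (Z' k) k := by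
  refine hasDerivAt_of_tendstoUniformlyOnFilter (l := atTop) (f := z) (f' := z') (g := Z) ?_
    (Eventually.of_forall fun p => hz _ _)
    (eventually_of_mem (hs.mem_nhds hk) hpt)
  refine Metric.tendstoUniformlyOnFilter_iff.2 fun ε hε => ?_
  filter_upwards [(Metric.tendsto_nhds.1 hzZ (ε / 2) (half_pos hε)),
    (Metric.tendsto_nhds.1 hZc (ε / 2) (half_pos hε)).prod_inr atTop] with p hp1 hp2
  rw [dist_comm] at hp1
  exact (dist_triangle _ (Z' k) _).trans_lt (by linarith)

/-- A mean value bound on a symmetric interval. -/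
theorem abs_le_mul_of_abs_deriv_le {z z' : ℝ → ℝ} {A η : ℝ} (hz0 : z 0 = 0)
    (hz : ∀ k, HasDerivAt z (z' k) k) (hA : ∀ k ∈ Icc (-η) η, |z' k| ≤ A) :
    ∀ k ∈ Icc (-η) η, |z k| ≤ A * η := by
  intro k hk
  have hA0 : 0 ≤ A := (abs_nonneg _).trans (hA k hk)
  have := (convex_Icc (-η) η).norm_image_sub_le_of_norm_hasDerivWithin_le (f := z) (f' := z')
    (C := A) (fun t _ => (hz t).hasDerivWithinAt) hA (x := 0) (y := k)
    ⟨by linarith [hk.1, hk.2], by linarith [hk.1, hk.2]⟩ hk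
  rw [hz0, sub_zero, sub_zero, Real.norm_eq_abs, Real.norm_eq_abs] at this
  exact this.trans (mul_le_mul_of_nonneg_left (abs_le.2 hk) hA0)

/-- Local solvability of the singular system `x' = g(k, x, y)`,
`x² y' = κ(k, x, y) y + x R(k, x, y)`, `x(0) = 0`, with globally Lipschitz bounded coefficients and
`κ < 0` bounded away from `0`. The second equation is expressed through the derivative of
`x² y`, which makes sense where `x` vanishes. -/
theorem exists_singular_solution_of_lipschitz {g κ R : ℝ × ℝ × ℝ → ℝ} {L B κ₀ ρ : ℝ}
    (hg : Continuous g) (hκ : Continuous κ) (hR : Continuous R)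
    (hκ₀ : 0 < κ₀) (hB : 0 ≤ B) (hL : 0 ≤ L) (hρ : 0 < ρ)
    (hgB : ∀ p, |g p| ≤ B) (hκB : ∀ p, |κ p| ≤ B) (hRB : ∀ p, |R p| ≤ B)
    (hκneg : ∀ p, κ p ≤ -κ₀)
    (hgL : ∀ k x₁ y₁ x₂ y₂, |g (k, x₁, y₁) - g (k, x₂, y₂)| ≤ L * (|x₁ - x₂| + |y₁ - y₂|))
    (hκL : ∀ k x₁ y₁ x₂ y₂, |κ (k, x₁, y₁) - κ (k, x₂, y₂)| ≤ L * (|x₁ - x₂| + |y₁ - y₂|))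
    (hRL : ∀ k x₁ y₁ x₂ y₂, |R (k, x₁, y₁) - R (k, x₂, y₂)| ≤ L * (|x₁ - x₂| + |y₁ - y₂|)) :
    ∃ η > 0, η ≤ ρ ∧ ∃ x y : ℝ → ℝ, x 0 = 0 ∧
      ∀ k ∈ Ioo (-η) η, |x k| ≤ ρ ∧ |y k| ≤ ρ ∧ ContinuousAt y k ∧
        HasDerivAt x (g (k, x k, y k)) k ∧
        HasDerivAt (fun k => x k ^ 2 * y k) (2 * x k * g (k, x k, y k) * y k +
          κ (k, x k, y k) * y k + x k * R (k, x k, y k)) k := by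
  set K : ℝ := 2 * B / κ₀ with hKdef
  have hK : 0 ≤ K := by positivity
  set C : ℝ := 1 + (1 + B + 4 * (B * (K + 1))) / κ₀ with hCdef
  have hC : 1 ≤ C := by
    have : 0 ≤ (1 + B + 4 * (B * (K + 1))) / κ₀ := by positivity
    linarith
  have ev : ∀ c d : ℝ, 0 < d → ∀ᶠ η in 𝓝[>] (0:ℝ), c * η ≤ d := by
    intro c d hd
    have : Tendsto (fun η : ℝ => c * η) (𝓝[>] 0) (𝓝 (c * 0)) :=
      (tendsto_id.const_mul c).mono_left nhdsWithin_le_nhds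
    rw [mul_zero] at this
    exact (this.eventually (gt_mem_nhds hd)).mono fun _ h => h.le
  obtain ⟨η, ⟨⟨⟨⟨⟨⟨⟨⟨⟨h1, h2⟩, h3⟩, h4⟩, h5⟩, h6⟩, h7⟩, h8⟩, h9⟩, hη⟩⟩ :=
    (((((((((ev 1 1 one_pos).and (ev 1 ρ hρ)).and (ev (B * B) (κ₀ / 2) (by positivity))).and
      (ev B ρ hρ)).and (ev (K * (B + 1)) ρ hρ)).and
      (ev (K * (B + 1)) 1 one_pos)).and (ev (L * (1 + 2 * C)) (1 / 2) (by norm_num))).and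
      (ev (L * (1 + 2 * C) * (K * (B + 1) + B)) 1 one_pos)).and (ev B 1 one_pos)).and
      (self_mem_nhdsWithin (s := Ioi (0:ℝ))) |>.exists
  replace hη : 0 < η := hη
  rw [one_mul] at h1 h2
  have hstep : ∀ (n : ℕ) (s : {p : (ℝ → ℝ) × (ℝ → ℝ) // Continuous p.1 ∧ Continuous p.2}),
      ∃ s' : {p : (ℝ → ℝ) × (ℝ → ℝ) // Continuous p.1 ∧ Continuous p.2},
        s'.1.1 0 = 0 ∧ (∀ k, HasDerivAt s'.1.1 (g (k, s.1.1 k, s.1.2 k)) k) ∧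
        s'.1.2 (-η) = 0 ∧ ∃ y' : ℝ → ℝ, (∀ k, HasDerivAt s'.1.2 (y' k) k) ∧
        ∀ k, (s.1.1 k ^ 2 + (η * (3 / 4) ^ n) ^ 2) * y' k =
          κ (k, s.1.1 k, s.1.2 k) * s'.1.2 k + s.1.1 k * R (k, s.1.1 k, s.1.2 k) := by
    rintro n ⟨⟨x, y⟩, hx, hy⟩
    dsimp only at hx hy ⊢
    have hp : Continuous fun k => (k, x k, y k) := by fun_prop
    have hpos : ∀ k, x k ^ 2 + (η * (3 / 4) ^ n) ^ 2 ≠ 0 := fun k => by positivity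
    have hm : Continuous fun k => x k ^ 2 + (η * (3 / 4) ^ n) ^ 2 := by fun_prop
    have hgp : Continuous fun k => g (k, x k, y k) := hg.comp hp
    obtain ⟨Y, hY0, hY⟩ := exists_hasDerivAt_linear ((hκ.comp hp).div hm hpos)
      ((hx.mul (hR.comp hp)).div hm hpos) (-η)
    have hX : ∀ k, HasDerivAt (fun k => ∫ s in (0:ℝ)..k, g (s, x s, y s)) (g (k, x k, y k)) k :=
      fun k => intervalIntegral.integral_hasDerivAt_right (hgp.intervalIntegrable _ _)
        (hgp.stronglyMeasurableAtFilter _ _) hgp.continuousAt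
    refine ⟨⟨⟨fun k => ∫ s in (0:ℝ)..k, g (s, x s, y s), Y⟩,
      continuous_iff_continuousAt.2 fun t => (hX t).continuousAt,
      continuous_iff_continuousAt.2 fun t => (hY t).continuousAt⟩, by simp, hX, hY0, _, hY, ?_⟩
    intro k
    have := hpos k
    simp only [Pi.div_apply, Pi.mul_apply, Function.comp_apply]
    field_simp
  choose step hs0 hsx hsa y' hsy hsm using hstep
  let s : ℕ → {p : (ℝ → ℝ) × (ℝ → ℝ) // Continuous p.1 ∧ Continuous p.2} := fun n =>
    Nat.rec ⟨⟨fun _ => 0, fun _ => 0⟩, continuous_const, continuous_const⟩ step n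
  let x : ℕ → ℝ → ℝ := fun n => (s n).1.1
  let y : ℕ → ℝ → ℝ := fun n => (s n).1.2
  have hx0 : ∀ n, x n 0 = 0 := by
    rintro (_ | n)
    · rfl
    · exact hs0 n (s n)
  have hx' : ∀ n k, HasDerivAt (x (n + 1)) (g (k, x n k, y n k)) k := fun n => hsx n (s n)
  have hya : ∀ n, y (n + 1) (-η) = 0 := fun n => hsa n (s n)
  have hy' : ∀ n k, HasDerivAt (y (n + 1)) (y' n (s n) k) k := fun n => hsy n (s n)
  have hym : ∀ n k, (x n k ^ 2 + (η * (3 / 4) ^ n) ^ 2) * y' n (s n) k =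
      κ (k, x n k, y n k) * y (n + 1) k + x n k * R (k, x n k, y n k) := fun n => hsm n (s n)
  have hxz : ∀ k, x 0 k = 0 := fun k => rfl
  have hyz : ∀ k, y 0 k = 0 := fun k => rfl
  have hxc : ∀ n, Continuous (x n) := fun n => (s n).2.1
  have hyc : ∀ n, Continuous (y n) := fun n => (s n).2.2
  clear_value x y
  have hq : ∀ n : ℕ, (0:ℝ) < (3 / 4) ^ n := fun n => by positivity
  have hq1 : ∀ n : ℕ, ((3:ℝ) / 4) ^ n ≤ 1 := fun n => pow_le_one₀ (by norm_num) (by norm_num)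
  have hεpos : ∀ n : ℕ, 0 < η * (3 / 4) ^ n := fun n => mul_pos hη (hq n)
  -- bounds on the `x` component
  have hxb : ∀ n, ∀ k ∈ Icc (-η) η, |x n k| ≤ B * η := by
    rintro (_ | n) k hk
    · rw [hxz, abs_zero]; positivity
    · exact abs_le_mul_of_abs_deriv_le (hx0 _) (hx' n) (fun k _ => hgB _) k hk
  have hrb : ∀ n, ∀ k ∈ Icc (-η) η, √(x n k ^ 2 + (η * (3 / 4) ^ n) ^ 2) ≤ (B + 1) * η := by
    intro n k hk
    have := abs_sqrt_add_sq_sub_le (x n k) 0 (η * (3 / 4) ^ n) 0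
    simp only [ne_eq, OfNat.ofNat_ne_zero, not_false_eq_true, zero_pow, add_zero, Real.sqrt_zero,
      sub_zero, abs_of_pos (hεpos n), abs_of_nonneg (Real.sqrt_nonneg _)] at this
    nlinarith [hxb n k hk, hq1 n]
  -- bounds on the `y` component
  have hyr : ∀ n, ∀ k ∈ Icc (-η) η,
      |y (n + 1) k| ≤ K * √(x n k ^ 2 + (η * (3 / 4) ^ n) ^ 2) := by
    intro n
    have hxx : ∃ x' : ℝ → ℝ, (∀ k, HasDerivAt (x n) (x' k) k) ∧ ∀ k, |x' k| ≤ B := by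
      rcases n with _ | n
      · refine ⟨fun _ => 0, fun k => ?_, fun _ => by simpa using hB⟩
        rw [show x 0 = fun _ => 0 from funext hxz]
        exact hasDerivAt_const k 0
      · exact ⟨_, hx' n, fun _ => hgB _⟩
    obtain ⟨x', hx'n, hx'B⟩ := hxx
    refine abs_le_mul_sqrt_of_singular (κ := fun k => κ (k, x n k, y n k))
      (R := fun k => R (k, x n k, y n k)) (hεpos n) hκ₀ hB (fun k _ => hx'n k) (fun k hk => ?_)
      (fun k _ => hy' n k) (hya n) (fun k _ => hκneg _) (fun k _ => hRB _) (fun k _ => hym n k)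
    rw [abs_mul]
    calc _ ≤ (B * η) * B := mul_le_mul (hxb n k hk) (hx'B k) (abs_nonneg _) (by positivity)
      _ ≤ κ₀ / 2 := by linarith
  have hyb : ∀ n, ∀ k ∈ Icc (-η) η, |y n k| ≤ K * (B + 1) * η := by
    rintro (_ | n) k hk
    · rw [hyz, abs_zero]; positivity
    · refine (hyr n k hk).trans ?_
      rw [mul_assoc]
      exact mul_le_mul_of_nonneg_left (hrb n k hk) hK
  -- geometric decay of the increments
  have hcauchy : ∀ n, (∀ k ∈ Icc (-η) η, |x (n + 1) k - x n k| ≤ (3 / 4) ^ n) ∧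
      ∀ k ∈ Icc (-η) η, |y (n + 1) k - y n k| ≤ 2 * C * (3 / 4) ^ n := by
    intro n
    induction n with
    | zero =>
      refine ⟨fun k hk => ?_, fun k hk => ?_⟩
      · rw [hxz, sub_zero, pow_zero]
        exact (hxb 1 k hk).trans h9
      · rw [hyz, sub_zero, pow_zero]
        linarith [hyb 1 k hk]
    | succ n ih =>
      obtain ⟨ihx, ihy⟩ := ih
      have hsum : ∀ k ∈ Icc (-η) η, L * (|x (n + 1) k - x n k| + |y (n + 1) k - y n k|) ≤
          L * (1 + 2 * C) * (3 / 4) ^ n := by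
        intro k hk
        rw [mul_assoc]
        exact mul_le_mul_of_nonneg_left (by linarith [ihx k hk, ihy k hk]) hL
      refine ⟨fun k hk => ?_, fun k hk => ?_⟩
      · have := abs_le_mul_of_abs_deriv_le (z := fun k => x (n + 1 + 1) k - x (n + 1) k)
          (z' := fun k => g (k, x (n + 1) k, y (n + 1) k) - g (k, x n k, y n k))
          (A := L * (1 + 2 * C) * (3 / 4) ^ n) (by rw [hx0, hx0, sub_zero])
          (fun k => (hx' (n + 1) k).sub (hx' n k))
          (fun k hk => (hgL _ _ _ _ _).trans (hsum k hk)) k hk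
        refine this.trans ?_
        rw [pow_succ]
        nlinarith [hq n]
      · set q : ℝ := (3 / 4) ^ n with hqdef
        have hqn : 0 < q := hq n
        have hFb : ∀ n, ∀ k ∈ Icc (-η) η, |x n k * R (k, x n k, y n k)| ≤
            B * √(x n k ^ 2 + (η * (3 / 4) ^ n) ^ 2) := by
          intro n k _
          rw [abs_mul, mul_comm]
          exact mul_le_mul (hRB _) (Real.abs_le_sqrt (by nlinarith [hεpos n])) (abs_nonneg _) hB
        have hFd : ∀ k ∈ Icc (-η) η,
            |x (n + 1) k * R (k, x (n + 1) k, y (n + 1) k) - x n k * R (k, x n k, y n k)| ≤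
              B * q + B * η * (L * (1 + 2 * C) * q) := by
          intro k hk
          rw [show x (n + 1) k * R (k, x (n + 1) k, y (n + 1) k) - x n k * R (k, x n k, y n k) =
            R (k, x (n + 1) k, y (n + 1) k) * (x (n + 1) k - x n k) + x n k *
              (R (k, x (n + 1) k, y (n + 1) k) - R (k, x n k, y n k)) by ring]
          refine (abs_add_le _ _).trans (add_le_add ?_ ?_) <;> rw [abs_mul]
          · exact mul_le_mul (hRB _) (ihx k hk) (abs_nonneg _) hB
          · exact mul_le_mul (hxb n k hk) ((hRL _ _ _ _ _).trans (hsum k hk)) (abs_nonneg _)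
              (by positivity)
        have hQ : ∀ m, ∀ k ∈ Icc (-η) η,
            |κ (k, x (n + 1) k, y (n + 1) k) - κ (k, x n k, y n k)| * |y m k| +
            |x (n + 1) k * R (k, x (n + 1) k, y (n + 1) k) - x n k * R (k, x n k, y n k)| ≤
              L * (1 + 2 * C) * q * (K * (B + 1) * η) +
                (B * q + B * η * (L * (1 + 2 * C) * q)) := fun m k hk =>
          add_le_add (mul_le_mul ((hκL _ _ _ _ _).trans (hsum k hk)) (hyb m k hk) (abs_nonneg _)
            (by positivity)) (hFd k hk)
        have := abs_sub_le_of_singular (a := -η) (c := η) (d := 2 * q)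
          (κ₁ := fun k => κ (k, x (n + 1) k, y (n + 1) k)) (κ₂ := fun k => κ (k, x n k, y n k))
          (hεpos (n + 1)) (hεpos n) hκ₀ hB hK
          (Q := L * (1 + 2 * C) * q * (K * (B + 1) * η) +
                (B * q + B * η * (L * (1 + 2 * C) * q))) (by positivity) (by positivity)
          (fun k _ => hy' (n + 1) k) (fun k _ => hy' n k) (hya _) (hya _)
          (fun k _ => hκneg _) (fun k _ => hκneg _) (fun k _ => hκB _) (fun k _ => hκB _)
          (hFb (n + 1)) (hFb n) (hyr (n + 1)) (hyr n) (hQ _) (hQ _)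
          (fun k hk => by
            refine (abs_sqrt_add_sq_sub_le _ _ _ _).trans ?_
            have e1 : |η * (3 / 4) ^ (n + 1) - η * (3 / 4) ^ n| ≤ q := by
              rw [pow_succ, ← hqdef, abs_le]
              constructor <;> nlinarith
            linarith [ihx k hk])
          (fun k _ => hym (n + 1) k) (fun k _ => hym n k) k hk
        refine this.trans ?_
        rw [div_le_iff₀ hκ₀, pow_succ, ← hqdef]
        have hCκ : C * κ₀ = κ₀ + (1 + B + 4 * (B * (K + 1))) := by
          rw [hCdef]; field_simp
        have e8 := mul_le_mul_of_nonneg_right h8 hqn.le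
        have e10 : 0 ≤ q * (B + 1 + 4 * (B * (K + 1)) + κ₀) := by positivity
        have : 2 * C * (q * (3 / 4)) * κ₀ =
          3 / 2 * (q * (B + 1 + 4 * (B * (K + 1)) + κ₀)) := by
          linear_combination (3 / 2 * q) * hCκ
        rw [this]
        nlinarith [mul_pos hqn hκ₀]
  -- passage to the limit
  obtain ⟨X, hX⟩ := exists_tendsto_prod_of_geometric (A := 1) hxc
    (fun n k hk => by simpa using (hcauchy n).1 k hk)
  obtain ⟨Y, hY⟩ := exists_tendsto_prod_of_geometric (A := 2 * C) hyc
    (fun n k hk => (hcauchy n).2 k hk)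
  have hpt : ∀ {z : ℕ → ℝ → ℝ} {Z : ℝ → ℝ} {k : ℝ},
      Tendsto (fun p : ℕ × ℝ => z p.1 p.2) (atTop ×ˢ 𝓝 k) (𝓝 (Z k)) →
      Tendsto (fun n => z n k) atTop (𝓝 (Z k)) := fun {z Z k} h =>
    h.comp (tendsto_id.prodMk (tendsto_const_nhds (x := k)))
  have hshift : ∀ {z : ℕ → ℝ → ℝ} {c k : ℝ},
      Tendsto (fun p : ℕ × ℝ => z p.1 p.2) (atTop ×ˢ 𝓝 k) (𝓝 c) →
      Tendsto (fun p : ℕ × ℝ => z (p.1 + 1) p.2) (atTop ×ˢ 𝓝 k) (𝓝 c) := fun {z c k} h =>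
    h.comp (((tendsto_add_atTop_nat 1).comp tendsto_fst).prodMk tendsto_snd)
  have hcoef : ∀ {h : ℝ × ℝ × ℝ → ℝ}, Continuous h → ∀ k ∈ Ioo (-η) η,
      ContinuousAt (fun k => h (k, X k, Y k)) k ∧
      Tendsto (fun p : ℕ × ℝ => h (p.2, x p.1 p.2, y p.1 p.2)) (atTop ×ˢ 𝓝 k)
        (𝓝 (h (k, X k, Y k))) := fun {h} hh k hk =>
    ⟨hh.continuousAt.comp (f := fun k => (k, X k, Y k))
      (continuousAt_id.prodMk ((hX k hk).1.prodMk (hY k hk).1)),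
      (hh.tendsto _).comp (tendsto_snd.prodMk_nhds ((hX k hk).2.prodMk_nhds (hY k hk).2))⟩
  refine ⟨η, hη, h2, X, Y, ?_, fun k hk => ⟨?_, ?_, (hY k hk).1, ?_, ?_⟩⟩
  · refine tendsto_nhds_unique (hpt (hX 0 ⟨by linarith, hη⟩).2) ?_
    simp only [hx0]
    exact tendsto_const_nhds
  · exact le_of_tendsto (hpt (hX k hk).2).abs
      (Eventually.of_forall fun n => (hxb n k (Ioo_subset_Icc_self hk)).trans h4)
  · exact le_of_tendsto (hpt (hY k hk).2).abs
      (Eventually.of_forall fun n => (hyb n k (Ioo_subset_Icc_self hk)).trans h5)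
  · exact hasDerivAt_of_tendsto_prod (z := fun n => x (n + 1)) (Z' := fun k => g (k, X k, Y k))
      isOpen_Ioo hk hx' (hcoef hg k hk).1
      (hcoef hg k hk).2 (fun k hk => hpt (hshift (hX k hk).2))
  · have hε : ∀ k : ℝ, Tendsto (fun p : ℕ × ℝ => (η * (3 / 4) ^ (p.1 + 1)) ^ 2) (atTop ×ˢ 𝓝 k)
        (𝓝 0) := by
      intro k
      have h0 : Tendsto (fun n : ℕ => (η * (3 / 4 : ℝ) ^ n) ^ 2) atTop (𝓝 0) := by
        have := ((tendsto_pow_atTop_nhds_zero_of_lt_one (r := (3 / 4 : ℝ)) (by norm_num)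
          (by norm_num)).const_mul η).pow 2
        simpa using this
      exact h0.comp ((tendsto_add_atTop_nat 1).comp tendsto_fst)
    have hprod := fun k hk => ((hshift (hX k hk).2).pow 2).add (hε k)
    refine hasDerivAt_of_tendsto_prod (s := Ioo (-η) η)
      (z := fun n k => (x (n + 1) k ^ 2 + (η * (3 / 4) ^ (n + 1)) ^ 2) * y (n + 2) k)
      (z' := fun n k => 2 * x (n + 1) k * g (k, x n k, y n k) * y (n + 2) k +
        κ (k, x (n + 1) k, y (n + 1) k) * y (n + 2) k +
        x (n + 1) k * R (k, x (n + 1) k, y (n + 1) k)) (Z := fun k => X k ^ 2 * Y k)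
      (Z' := fun k => 2 * X k * g (k, X k, Y k) * Y k +
          κ (k, X k, Y k) * Y k + X k * R (k, X k, Y k)) isOpen_Ioo hk ?_ ?_ ?_ ?_
    · intro n k
      refine ((((hx' n k).pow 2).add_const _).mul (hy' (n + 1) k)).congr_deriv ?_
      have := hym (n + 1) k
      simp only [Pi.pow_apply, Nat.cast_ofNat, Nat.add_one_sub_one, pow_one]
      linear_combination this
    · have := (hX k hk).1
      have := (hY k hk).1
      have := (hcoef hg k hk).1
      have := (hcoef hκ k hk).1
      have := (hcoef hR k hk).1
      fun_prop
    · have t1 := hshift (hX k hk).2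
      have t2 := hshift (z := fun n => y (n + 1)) (hshift (hY k hk).2)
      exact (((t1.const_mul 2).mul (hcoef hg k hk).2).mul t2).add
        ((hshift (z := fun n k => κ (k, x n k, y n k)) (hcoef hκ k hk).2).mul t2) |>.add
        (t1.mul (hshift (z := fun n k => R (k, x n k, y n k)) (hcoef hR k hk).2))
    · intro k hk
      have := (hprod k hk).mul (hshift (z := fun n => y (n + 1)) (hshift (hY k hk).2))
      rw [add_zero] at this
      exact hpt (z := fun n k => (x (n + 1) k ^ 2 + (η * (3 / 4) ^ (n + 1)) ^ 2) * y (n + 2) k)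
        (Z := fun k => X k ^ 2 * Y k) this

/-- Truncation of a real number to `[-ρ, ρ]`. -/
noncomputable def clamp (ρ t : ℝ) : ℝ := max (-ρ) (min ρ t)

theorem abs_clamp_le {ρ : ℝ} (hρ : 0 ≤ ρ) (t : ℝ) : |clamp ρ t| ≤ ρ :=
  abs_le.2 ⟨le_max_left _ _, max_le (by linarith) (min_le_left _ _)⟩

theorem clamp_eq_self {ρ t : ℝ} (h : |t| ≤ ρ) : clamp ρ t = t := by
  rw [clamp, min_eq_right (abs_le.1 h).2, max_eq_right (abs_le.1 h).1]

theorem continuous_clamp (ρ : ℝ) : Continuous (clamp ρ) := by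
  unfold clamp; fun_prop

theorem abs_clamp_sub_clamp_le (ρ t₁ t₂ : ℝ) : |clamp ρ t₁ - clamp ρ t₂| ≤ |t₁ - t₂| := by
  unfold clamp
  refine (abs_max_sub_max_le_max _ _ _ _).trans (max_le (by simp) ?_)
  exact (abs_min_sub_min_le_max _ _ _ _).trans (max_le (by simp) le_rfl)

/-- Composing a function that is Lipschitz on a ball with truncations gives a bounded globally
Lipschitz function. -/
theorem clamp_comp_bounds {h : ℝ × ℝ × ℝ → ℝ} {k₀ ρ σ : ℝ} {L : NNReal} (hρ : 0 ≤ ρ)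
    (hσ : |σ| = 1) (hL : LipschitzOnWith L h (Metric.closedBall (k₀, 0, 0) ρ)) :
    Continuous (fun p : ℝ × ℝ × ℝ =>
      σ * h (k₀ + σ * clamp ρ p.1, clamp ρ p.2.1, clamp ρ p.2.2)) ∧
    (∀ p : ℝ × ℝ × ℝ, |σ * h (k₀ + σ * clamp ρ p.1, clamp ρ p.2.1, clamp ρ p.2.2)| ≤
      |h (k₀, 0, 0)| + L * ρ) ∧
    ∀ k x₁ y₁ x₂ y₂, |σ * h (k₀ + σ * clamp ρ k, clamp ρ x₁, clamp ρ y₁) -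
      σ * h (k₀ + σ * clamp ρ k, clamp ρ x₂, clamp ρ y₂)| ≤ L * (|x₁ - x₂| + |y₁ - y₂|) := by
  have hmem : ∀ k x y, (k₀ + σ * clamp ρ k, clamp ρ x, clamp ρ y) ∈
      Metric.closedBall ((k₀, 0, 0) : ℝ × ℝ × ℝ) ρ := by
    intro k x y
    rw [Metric.mem_closedBall, Prod.dist_eq, Prod.dist_eq, Real.dist_eq, Real.dist_eq,
      Real.dist_eq]
    refine max_le ?_ (max_le ?_ ?_)
    · dsimp only
      rw [add_sub_cancel_left, abs_mul, hσ, one_mul]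
      exact abs_clamp_le hρ k
    · simpa using abs_clamp_le hρ x
    · simpa using abs_clamp_le hρ y
  refine ⟨?_, fun p => ?_, fun k x₁ y₁ x₂ y₂ => ?_⟩
  · have := continuous_clamp ρ
    exact continuous_const.mul (hL.continuousOn.comp_continuous (by fun_prop)
      (fun p => hmem _ _ _))
  · rw [abs_mul, hσ, one_mul]
    have h1 := hL.dist_le_mul _ (hmem p.1 p.2.1 p.2.2) _ (Metric.mem_closedBall_self hρ)
    have h2 := mul_le_mul_of_nonneg_left (Metric.mem_closedBall.1 (hmem p.1 p.2.1 p.2.2)) L.2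
    rw [Real.dist_eq] at h1
    have h3 := abs_sub_abs_le_abs_sub
      (h (k₀ + σ * clamp ρ p.1, clamp ρ p.2.1, clamp ρ p.2.2)) (h (k₀, 0, 0))
    exact sub_le_iff_le_add'.1 (h3.trans (h1.trans h2))
  · rw [← mul_sub, abs_mul, hσ, one_mul, ← Real.dist_eq]
    refine (hL.dist_le_mul _ (hmem k x₁ y₁) _ (hmem k x₂ y₂)).trans
      (mul_le_mul_of_nonneg_left ?_ L.2)
    rw [Prod.dist_eq, Prod.dist_eq, Real.dist_eq, Real.dist_eq, Real.dist_eq]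
    have e1 := abs_clamp_sub_clamp_le ρ x₁ x₂
    have e2 := abs_clamp_sub_clamp_le ρ y₁ y₂
    have := abs_nonneg (x₁ - x₂)
    have := abs_nonneg (y₁ - y₂)
    refine max_le ?_ (max_le ?_ ?_) <;> dsimp only
    · rw [sub_self, abs_zero]; positivity
    · linarith
    · linarith

/-- Local solvability of the singular system `x' = g(k, x, y)`,
`x² y' = κ(k, x, y) y + x R(k, x, y)`, `x(k₀) = 0`, when `κ(k₀, 0, 0) ≠ 0`. -/
theorem exists_singular_solution {g κ R : ℝ × ℝ × ℝ → ℝ} {k₀ : ℝ}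
    (hg : ContDiffAt ℝ 1 g (k₀, 0, 0)) (hκ : ContDiffAt ℝ 1 κ (k₀, 0, 0))
    (hR : ContDiffAt ℝ 1 R (k₀, 0, 0)) (hκ0 : κ (k₀, 0, 0) ≠ 0)
    {O : Set (ℝ × ℝ)} (hO : O ∈ 𝓝 (k₀, (0:ℝ))) :
    ∃ η > 0, ∃ x y : ℝ → ℝ, x k₀ = 0 ∧
      ∀ k ∈ Ioo (k₀ - η) (k₀ + η), (k, x k) ∈ O ∧ ContinuousAt y k ∧
        HasDerivAt x (g (k, x k, y k)) k ∧
        HasDerivAt (fun k => x k ^ 2 * y k) (2 * x k * g (k, x k, y k) * y k +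
          κ (k, x k, y k) * y k + x k * R (k, x k, y k)) k := by
  obtain ⟨σ, hσ, hσκ⟩ : ∃ σ : ℝ, |σ| = 1 ∧ σ * κ (k₀, 0, 0) < 0 := by
    rcases hκ0.lt_or_gt with h | h
    · exact ⟨1, by simp, by simpa using h⟩
    · exact ⟨-1, by simp, by simpa using h⟩
  have hσσ : σ * σ = 1 := by rw [← abs_mul_abs_self, hσ, one_mul]
  obtain ⟨L₁, t₁, ht₁, hL₁⟩ := hg.exists_lipschitzOnWith
  obtain ⟨L₂, t₂, ht₂, hL₂⟩ := hκ.exists_lipschitzOnWith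
  obtain ⟨L₃, t₃, ht₃, hL₃⟩ := hR.exists_lipschitzOnWith
  have ht₄ : {p : ℝ × ℝ × ℝ | σ * κ p < σ * κ (k₀, 0, 0) / 2} ∈ 𝓝 (k₀, (0:ℝ), (0:ℝ)) := by
    have : ContinuousAt (fun p => σ * κ p) (k₀, 0, 0) := continuousAt_const.mul hκ.continuousAt
    exact this.eventually (gt_mem_nhds (by linarith))
  have ht₅ : (fun p : ℝ × ℝ × ℝ => (p.1, p.2.1)) ⁻¹' O ∈ 𝓝 (k₀, (0:ℝ), (0:ℝ)) :=
    ContinuousAt.preimage_mem_nhds (by fun_prop) hO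
  obtain ⟨ρ, hρ, hball⟩ := Metric.nhds_basis_closedBall.mem_iff.1
    (inter_mem (inter_mem (inter_mem (inter_mem ht₁ ht₂) ht₃) ht₄) ht₅)
  have hmem : ∀ {k x y : ℝ}, |k| ≤ ρ → |x| ≤ ρ → |y| ≤ ρ →
      (k₀ + σ * k, x, y) ∈ Metric.closedBall ((k₀, 0, 0) : ℝ × ℝ × ℝ) ρ := by
    intro k x y hk hx hy
    rw [Metric.mem_closedBall, Prod.dist_eq, Prod.dist_eq, Real.dist_eq, Real.dist_eq,
      Real.dist_eq]
    refine max_le ?_ (max_le ?_ ?_)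
    · dsimp only
      rwa [add_sub_cancel_left, abs_mul, hσ, one_mul]
    · simpa using hx
    · simpa using hy
  obtain ⟨c₁, b₁, l₁⟩ := clamp_comp_bounds hρ.le hσ
    (hL₁.mono (hball.trans fun p hp => hp.1.1.1.1))
  obtain ⟨c₂, b₂, l₂⟩ := clamp_comp_bounds hρ.le hσ
    (hL₂.mono (hball.trans fun p hp => hp.1.1.1.2))
  obtain ⟨c₃, b₃, l₃⟩ := clamp_comp_bounds hρ.le hσ
    (hL₃.mono (hball.trans fun p hp => hp.1.1.2))
  have n₁ : 0 ≤ |g (k₀, 0, 0)| + L₁ * ρ := by positivity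
  have n₂ : 0 ≤ |κ (k₀, 0, 0)| + L₂ * ρ := by positivity
  have n₃ : 0 ≤ |R (k₀, 0, 0)| + L₃ * ρ := by positivity
  have hlip : ∀ {r : ℝ} {L : NNReal} {x y : ℝ}, r ≤ L * (|x| + |y|) → L ≤ L₁ + L₂ + L₃ →
      r ≤ ((L₁ + L₂ + L₃ : NNReal) : ℝ) * (|x| + |y|) := fun h hL =>
    h.trans (mul_le_mul_of_nonneg_right (by exact_mod_cast hL) (by positivity))
  obtain ⟨η, hη, hηρ, X, Y, hX0, hXY⟩ := exists_singular_solution_of_lipschitz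
    (L := ((L₁ + L₂ + L₃ : NNReal) : ℝ)) (κ₀ := -(σ * κ (k₀, 0, 0) / 2))
    (B := (|g (k₀, 0, 0)| + L₁ * ρ) + (|κ (k₀, 0, 0)| + L₂ * ρ) + (|R (k₀, 0, 0)| + L₃ * ρ))
    c₁ c₂ c₃ (by linarith) (by positivity) (NNReal.coe_nonneg _) hρ
    (fun p => (b₁ p).trans (by linarith)) (fun p => (b₂ p).trans (by linarith))
    (fun p => (b₃ p).trans (by linarith))
    (fun p => by
      rw [neg_neg]
      exact (hball (hmem (abs_clamp_le hρ.le _) (abs_clamp_le hρ.le _)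
        (abs_clamp_le hρ.le _))).1.2.le)
    (fun _ _ _ _ _ => hlip (l₁ _ _ _ _ _) (by rw [add_assoc]; exact le_self_add))
    (fun _ _ _ _ _ => hlip (l₂ _ _ _ _ _) (by rw [add_right_comm]; exact le_add_self))
    (fun _ _ _ _ _ => hlip (l₃ _ _ _ _ _) le_add_self)
  refine ⟨η, hη, fun k => X (σ * (k - k₀)), fun k => Y (σ * (k - k₀)), by simpa using hX0,
    fun k hk => ?_⟩
  have hs' : |σ * (k - k₀)| < η := by
    rw [abs_mul, hσ, one_mul, abs_lt]
    constructor <;> linarith [hk.1, hk.2]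
  obtain ⟨hx, hy, hYc, hX', hXY'⟩ := hXY (σ * (k - k₀)) (abs_lt.1 hs')
  have hsρ : |σ * (k - k₀)| ≤ ρ := hs'.le.trans hηρ
  have hk' : k₀ + σ * (σ * (k - k₀)) = k := by rw [← mul_assoc, hσσ]; ring
  simp only [clamp_eq_self hx, clamp_eq_self hy, clamp_eq_self hsρ, hk'] at hX' hXY'
  have hin := hball (hmem hsρ hx hy)
  rw [hk'] at hin
  have hφ : HasDerivAt (fun k => σ * (k - k₀)) σ k := by
    simpa using ((hasDerivAt_id k).sub_const k₀).const_mul σ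
  refine ⟨hin.2, ContinuousAt.comp (f := fun k => σ * (k - k₀)) hYc hφ.continuousAt, ?_, ?_⟩
  · refine (HasDerivAt.comp k hX' hφ).congr_deriv ?_
    linear_combination g (k, X (σ * (k - k₀)), Y (σ * (k - k₀))) * hσσ
  · refine (HasDerivAt.comp k hXY' hφ).congr_deriv ?_
    linear_combination (2 * X (σ * (k - k₀)) * g (k, X (σ * (k - k₀)), Y (σ * (k - k₀))) *
      Y (σ * (k - k₀)) + κ (k, X (σ * (k - k₀)), Y (σ * (k - k₀))) * Y (σ * (k - k₀)) +
      X (σ * (k - k₀)) * R (k, X (σ * (k - k₀)), Y (σ * (k - k₀)))) * hσσ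

/-- Partial derivative with respect to the first variable. -/
noncomputable def dfst (F : ℝ × ℝ → ℝ) (p : ℝ × ℝ) : ℝ := fderiv ℝ F p (1, 0)

/-- Partial derivative with respect to the second variable. -/
noncomputable def dsnd (F : ℝ × ℝ → ℝ) (p : ℝ × ℝ) : ℝ := fderiv ℝ F p (0, 1)

theorem contDiffOn_dfst {F : ℝ × ℝ → ℝ} {O : Set (ℝ × ℝ)} (hO : IsOpen O)
    (hF : ContDiffOn ℝ (⊤ : ℕ∞) F O) : ContDiffOn ℝ (⊤ : ℕ∞) (dfst F) O :=
  (hF.fderiv_of_isOpen (m := (⊤ : ℕ∞)) hO le_rfl).clm_apply contDiffOn_const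

theorem contDiffOn_dsnd {F : ℝ × ℝ → ℝ} {O : Set (ℝ × ℝ)} (hO : IsOpen O)
    (hF : ContDiffOn ℝ (⊤ : ℕ∞) F O) : ContDiffOn ℝ (⊤ : ℕ∞) (dsnd F) O :=
  (hF.fderiv_of_isOpen (m := (⊤ : ℕ∞)) hO le_rfl).clm_apply contDiffOn_const

theorem hasDerivAt_comp_graph {F : ℝ × ℝ → ℝ} {x : ℝ → ℝ} {x' k : ℝ}
    (hF : DifferentiableAt ℝ F (k, x k)) (hx : HasDerivAt x x' k) :
    HasDerivAt (fun k => F (k, x k)) (dfst F (k, x k) + dsnd F (k, x k) * x') k := by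
  have h := hF.hasFDerivAt.comp_hasDerivAt k ((hasDerivAt_id k).prodMk hx)
  refine h.congr_deriv ?_
  have e : ((1, x') : ℝ × ℝ) = (1, 0) + x' • (0, 1) := by simp
  rw [e, map_add, map_smul, smul_eq_mul, mul_comm, dfst, dsnd]

/-- Existence of a pair `v`, `w` with `x r + X = δ₁ v`, `x q + Y = δ₂ w`, where `r = v'`, `q = w'`
and `r + q = -(∂X/∂x + ∂Y/∂x)`, along a curve `x` with `x(k₀) = 0`. -/
theorem exists_value_pair {X Y : ℝ × ℝ → ℝ} {O : Set (ℝ × ℝ)} {k₀ δ₁ δ₂ : ℝ} (hO : IsOpen O)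
    (hk₀ : (k₀, 0) ∈ O) (hX : ContDiffOn ℝ (⊤ : ℕ∞) X O) (hY : ContDiffOn ℝ (⊤ : ℕ∞) Y O)
    (hδ₁ : δ₁ ≠ 0) (hδ₂ : δ₂ ≠ 0) (hδ : δ₁ - δ₂ ≠ 0)
    (hP : dsnd (fun p => -(dsnd X p + dsnd Y p)) (k₀, 0) ≠ 0)
    (hτ : δ₁ * (-(dsnd X (k₀, 0) + dsnd Y (k₀, 0))) - dfst X (k₀, 0) - dfst Y (k₀, 0) +
      (δ₁ - δ₂) * dsnd Y (k₀, 0) ≠ 0) :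
    ∃ N : Set ℝ, IsOpen N ∧ k₀ ∈ N ∧ ∃ x v w r q : ℝ → ℝ, x k₀ = 0 ∧ ContDiffOn ℝ 1 x N ∧
      ContinuousOn r N ∧ ContinuousOn q N ∧ ∀ k ∈ N, (k, x k) ∈ O ∧
        HasDerivAt v (r k) k ∧ HasDerivAt w (q k) k ∧
        r k + q k = -(dsnd X (k, x k) + dsnd Y (k, x k)) ∧
        x k * r k + X (k, x k) = δ₁ * v k ∧ x k * q k + Y (k, x k) = δ₂ * w k := by
  set P : ℝ × ℝ → ℝ := fun p => -(dsnd X p + dsnd Y p) with hPdef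
  set S : ℝ × ℝ → ℝ := fun p => δ₁ * P p - dfst X p - dfst Y p with hSdef
  set τ : ℝ × ℝ → ℝ := fun p => S p + (δ₁ - δ₂) * dsnd Y p with hτdef
  have sX1 := contDiffOn_dfst hO hX
  have sX2 := contDiffOn_dsnd hO hX
  have sY1 := contDiffOn_dfst hO hY
  have sY2 := contDiffOn_dsnd hO hY
  have sP : ContDiffOn ℝ (⊤ : ℕ∞) P O := (sX2.add sY2).neg
  have sS : ContDiffOn ℝ (⊤ : ℕ∞) S O := ((contDiffOn_const.mul sP).sub sX1).sub sY1
  have sτ : ContDiffOn ℝ (⊤ : ℕ∞) τ O := sS.add (contDiffOn_const.mul sY2)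
  have sP1 := contDiffOn_dfst hO sP
  have sP2 := contDiffOn_dsnd hO sP
  -- restrict to the open set where the denominators do not vanish
  set D : Set (ℝ × ℝ) := O ∩ (fun p => dsnd P p * τ p) ⁻¹' {0}ᶜ with hDdef
  have hD : IsOpen D := (sP2.mul sτ).continuousOn.isOpen_inter_preimage hO isOpen_compl_singleton
  have hDO : D ⊆ O := inter_subset_left
  have hDP : ∀ p ∈ D, dsnd P p ≠ 0 := fun p hp => left_ne_zero_of_mul hp.2
  have hDτ : ∀ p ∈ D, τ p ≠ 0 := fun p hp => right_ne_zero_of_mul hp.2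
  have hkD : (k₀, 0) ∈ D := ⟨hk₀, mul_ne_zero hP hτ⟩
  set G : ℝ × ℝ → ℝ := fun p => (δ₂ * S p - (δ₁ - δ₂) * dfst Y p) / τ p with hGdef
  have sG : ContDiffOn ℝ (⊤ : ℕ∞) G D :=
    (((contDiffOn_const.mul sS).sub (contDiffOn_const.mul sY1)).mono hDO).div (sτ.mono hDO) hDτ
  set M : ℝ × ℝ → ℝ := fun p => dfst P p + dsnd P p * G p with hMdef
  have sM : ContDiffOn ℝ (⊤ : ℕ∞) M D := (sP1.mono hDO).add ((sP2.mono hDO).mul sG)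
  set T : ℝ × ℝ → ℝ := fun p => S p - p.2 * M p with hTdef
  have sT : ContDiffOn ℝ (⊤ : ℕ∞) T D := (sS.mono hDO).sub (contDiffOn_snd.mul sM)
  have sT1 := contDiffOn_dfst hD sT
  have sT2 := contDiffOn_dsnd hD sT
  have lift : ∀ {F : ℝ × ℝ → ℝ}, ContDiffOn ℝ (⊤ : ℕ∞) F D →
      ContDiffAt ℝ 1 (fun p : ℝ × ℝ × ℝ => F (p.1, p.2.1)) (k₀, 0, 0) := by
    intro F hF
    have h1 : ContDiffAt ℝ 1 F (k₀, 0) :=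
      (hF.contDiffAt (hD.mem_nhds hkD)).of_le (by exact_mod_cast le_top)
    exact ContDiffAt.comp (g := F) (f := fun p : ℝ × ℝ × ℝ => (p.1, p.2.1)) (k₀, 0, 0) h1
      (by fun_prop)
  have ly : ContDiffAt ℝ 1 (fun p : ℝ × ℝ × ℝ => p.2.2) (k₀, 0, 0) := by fun_prop
  set g : ℝ × ℝ × ℝ → ℝ := fun p => G (p.1, p.2.1) + p.2.2 / dsnd P (p.1, p.2.1) with hgdef
  have sg : ContDiffAt ℝ 1 g (k₀, 0, 0) :=
    (lift sG).add (ly.div (lift (sP2.mono hDO)) (hDP _ hkD))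
  obtain ⟨η, hη, x, y, hx0, hxy⟩ := exists_singular_solution (g := g)
    (κ := fun p => τ (p.1, p.2.1) / dsnd P (p.1, p.2.1))
    (R := fun p => -M (p.1, p.2.1) * g p + δ₂ * M (p.1, p.2.1) + dfst T (p.1, p.2.1) +
      dsnd T (p.1, p.2.1) * g p + δ₂ * p.2.2 - 2 * g p * p.2.2) sg
    ((lift (sτ.mono hDO)).div (lift (sP2.mono hDO)) (hDP _ hkD))
    (((((((lift sM).neg.mul sg).add (contDiffAt_const.mul (lift sM))).add (lift sT1)).add
      ((lift sT2).mul sg)).add (contDiffAt_const.mul ly)).sub ((contDiffAt_const.mul sg).mul ly))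
    (div_ne_zero (hDτ _ hkD) (hDP _ hkD)) (hD.mem_nhds hkD)
  have hcomp : ∀ {F : ℝ × ℝ → ℝ}, ContDiffOn ℝ (⊤ : ℕ∞) F D →
      ∀ k ∈ Ioo (k₀ - η) (k₀ + η), ContinuousAt (fun k => F (k, x k)) k := fun {F} hF k hk =>
    ContinuousAt.comp (f := fun k => (k, x k))
      (hF.continuousOn.continuousAt (hD.mem_nhds (hxy k hk).1))
      (continuousAt_id.prodMk (hxy k hk).2.2.1.continuousAt)
  have hdiff : ∀ {F : ℝ × ℝ → ℝ} {E : Set (ℝ × ℝ)}, IsOpen E → ContDiffOn ℝ (⊤ : ℕ∞) F E →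
      ∀ p ∈ E, DifferentiableAt ℝ F p := fun hE hF p hp =>
    (hF.contDiffAt (hE.mem_nhds hp)).differentiableAt (by simp)
  have hgc : ∀ k ∈ Ioo (k₀ - η) (k₀ + η), ContinuousAt (fun k => g (k, x k, y k)) k :=
    fun k hk => (hcomp sG k hk).add ((hxy k hk).2.1.div (hcomp (sP2.mono hDO) k hk)
      (hDP _ (hxy k hk).1))
  set q : ℝ → ℝ := fun k => (T (k, x k) - x k * y k) / (δ₁ - δ₂) with hqdef
  have hqc : ∀ k ∈ Ioo (k₀ - η) (k₀ + η), ContinuousAt q k := fun k hk =>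
    ((hcomp sT k hk).sub ((hxy k hk).2.2.1.continuousAt.mul (hxy k hk).2.1)).div_const _
  refine ⟨Ioo (k₀ - η) (k₀ + η), isOpen_Ioo, ⟨by linarith, by linarith⟩, x,
    fun k => (x k * P (k, x k) - (x k * T (k, x k) - x k ^ 2 * y k) / (δ₁ - δ₂) +
      X (k, x k)) / δ₁,
    fun k => ((x k * T (k, x k) - x k ^ 2 * y k) / (δ₁ - δ₂) + Y (k, x k)) / δ₂,
    fun k => P (k, x k) - q k, q, hx0, ?_, ?_, ?_, fun k hk => ?_⟩
  · rw [← zero_add (1 : WithTop ℕ∞), contDiffOn_succ_iff_deriv_of_isOpen isOpen_Ioo]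
    refine ⟨fun k hk => (hxy k hk).2.2.1.differentiableAt.differentiableWithinAt, by simp, ?_⟩
    rw [contDiffOn_zero]
    refine ContinuousOn.congr (f := fun k => g (k, x k, y k))
      (fun k hk => (hgc k hk).continuousWithinAt) (fun k hk => (hxy k hk).2.2.1.deriv)
  · exact fun k hk => ((hcomp (sP.mono hDO) k hk).sub (hqc k hk)).continuousWithinAt
  · exact fun k hk => (hqc k hk).continuousWithinAt
  · obtain ⟨hkD, -, hx', hxy'⟩ := hxy k hk
    have dP := hasDerivAt_comp_graph (hdiff hO sP _ (hDO hkD)) hx'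
    have dX := hasDerivAt_comp_graph (hdiff hO hX _ (hDO hkD)) hx'
    have dY := hasDerivAt_comp_graph (hdiff hO hY _ (hDO hkD)) hx'
    have dT := hasDerivAt_comp_graph (hdiff hD sT _ hkD) hx'
    have eP := hDP _ hkD
    have eτ := hDτ _ hkD
    have eqT : T (k, x k) = S (k, x k) - x k * M (k, x k) := rfl
    have eqM : M (k, x k) = dfst P (k, x k) + dsnd P (k, x k) * G (k, x k) := rfl
    have eqS : S (k, x k) = δ₁ * P (k, x k) - dfst X (k, x k) - dfst Y (k, x k) := rfl
    have eqP : P (k, x k) = -(dsnd X (k, x k) + dsnd Y (k, x k)) := rfl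
    have eqτ : τ (k, x k) = S (k, x k) + (δ₁ - δ₂) * dsnd Y (k, x k) := rfl
    have eqG : τ (k, x k) * G (k, x k) = δ₂ * S (k, x k) - (δ₁ - δ₂) * dfst Y (k, x k) := by
      rw [hGdef]; exact mul_div_cancel₀ _ eτ
    have eqg : dsnd P (k, x k) * g (k, x k, y k) = dsnd P (k, x k) * G (k, x k) + y k := by
      rw [hgdef]; dsimp only; field_simp
    have eqκ : τ (k, x k) / dsnd P (k, x k) * y k =
        τ (k, x k) * g (k, x k, y k) - τ (k, x k) * G (k, x k) := by
      rw [hgdef]; dsimp only; field_simp; ring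
    have eqq : (δ₁ - δ₂) * q k = T (k, x k) - x k * y k := by
      rw [hqdef]; exact mul_div_cancel₀ _ hδ
    have hqd : HasDerivAt (fun k => (x k * T (k, x k) - x k ^ 2 * y k) / (δ₁ - δ₂))
        (δ₂ * q k - dfst Y (k, x k) - dsnd Y (k, x k) * g (k, x k, y k)) k := by
      refine (((hx'.mul dT).sub hxy').div_const _).congr_deriv ?_
      rw [div_eq_iff hδ]
      dsimp only
      rw [eqκ]
      linear_combination (-δ₂) * eqq + g (k, x k, y k) * eqT - g (k, x k, y k) * eqτ + eqG -
        δ₂ * eqT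
    have hxq : (x k * T (k, x k) - x k ^ 2 * y k) / (δ₁ - δ₂) = x k * q k := by
      rw [hqdef]; ring
    refine ⟨hDO hkD, ?_, ?_, by rw [← eqP]; ring, ?_, ?_⟩
    · refine ((((hx'.mul dP).sub hqd).add dX).div_const δ₁).congr_deriv ?_
      rw [div_eq_iff hδ₁]
      linear_combination eqq + eqT - x k * eqM + eqS + x k * eqg + g (k, x k, y k) * eqP
    · refine ((hqd.add dY).div_const δ₂).congr_deriv ?_
      rw [div_eq_iff hδ₂]
      ring
    · dsimp only; rw [hxq]; field_simp
    · dsimp only; rw [hxq]; field_simp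

section Utility

variable {f : ℝ → ℝ} {u : ℝ → ℝ → ℝ}

theorem pd1_eq_fderiv {c k : ℝ} (h : DifferentiableAt ℝ (fun p : ℝ × ℝ => u p.1 p.2) (c, k)) :
    pd1 u c k = fderiv ℝ (fun p : ℝ × ℝ => u p.1 p.2) (c, k) (1, 0) :=
  (HasFDerivAt.comp_hasDerivAt (f := fun x => (x, k)) c h.hasFDerivAt ((hasDerivAt_id c).prodMk (hasDerivAt_const c k))).deriv

theorem pd2_eq_fderiv {c k : ℝ} (h : DifferentiableAt ℝ (fun p : ℝ × ℝ => u p.1 p.2) (c, k)) :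
    pd2 u c k = fderiv ℝ (fun p : ℝ × ℝ => u p.1 p.2) (c, k) (0, 1) :=
  (h.hasFDerivAt.comp_hasDerivAt k ((hasDerivAt_const k c).prodMk (hasDerivAt_id k))).deriv

theorem differentiableAt_of_contDiffOn_quadrant {c k : ℝ}
    (hu : ContDiffOn ℝ (⊤ : ℕ∞) (fun p : ℝ × ℝ => u p.1 p.2) (Ioi 0 ×ˢ Ioi 0))
    (hc : 0 < c) (hk : 0 < k) : DifferentiableAt ℝ (fun p : ℝ × ℝ => u p.1 p.2) (c, k) :=
  (hu.contDiffAt ((isOpen_Ioi.prod isOpen_Ioi).mem_nhds (Set.mk_mem_prod hc hk))).differentiableAt (by simp)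

theorem pd1_strictAntiOn {k : ℝ} (hk : 0 < k) (hu11 : ∀ c > 0, ∀ k > 0, pd11 u c k < 0) :
    StrictAntiOn (fun c => pd1 u c k) (Ioi 0) := by
  refine strictAntiOn_of_deriv_neg (convex_Ioi 0) (fun c hc => ?_) (fun c hc => ?_)
  · have : deriv (fun c => pd1 u c k) c ≠ 0 := (hu11 c hc k hk).ne
    exact (differentiableAt_of_deriv_ne_zero this).continuousAt.continuousWithinAt
  · rw [interior_Ioi] at hc
    exact hu11 c hc k hk

theorem pd1_pos {c k : ℝ} (hc : 0 < c) (hk : 0 < k)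
    (hmono : StrictMonoOn (fun c => u c k) (Ioi 0))
    (hu11 : ∀ c > 0, ∀ k > 0, pd11 u c k < 0) : 0 < pd1 u c k := by
  have h1 : pd1 u (c + 1) k < pd1 u c k :=
    pd1_strictAntiOn hk hu11 hc (show (0 : ℝ) < c + 1 by linarith) (by linarith)
  refine lt_of_le_of_lt ?_ h1
  have hmem : Ioi (0 : ℝ) ∈ 𝓝 (c + 1) := Ioi_mem_nhds (by linarith)
  rw [pd1, ← derivWithin_of_mem_nhds hmem]
  exact hmono.monotoneOn.derivWithin_nonneg

theorem isOpen_consumption_pos (hf : ContDiffOn ℝ (⊤ : ℕ∞) f (Ioi 0)) :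
    IsOpen {p : ℝ × ℝ | 0 < p.1 ∧ 0 < f p.1 - p.2} := by
  have hO : IsOpen {p : ℝ × ℝ | 0 < p.1} := isOpen_lt continuous_const continuous_fst
  have hc : ContinuousOn (fun p : ℝ × ℝ => f p.1 - p.2) {p : ℝ × ℝ | 0 < p.1} :=
    (hf.continuousOn.comp continuousOn_fst fun p hp => hp).sub continuousOn_snd
  exact hc.isOpen_inter_preimage hO isOpen_Ioi

theorem contDiffOn_consumption (hf : ContDiffOn ℝ (⊤ : ℕ∞) f (Ioi 0))
    (hu : ContDiffOn ℝ (⊤ : ℕ∞) (fun p : ℝ × ℝ => u p.1 p.2) (Ioi 0 ×ˢ Ioi 0)) :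
    ContDiffOn ℝ (⊤ : ℕ∞) (fun p : ℝ × ℝ => u (f p.1 - p.2) p.1)
      {p : ℝ × ℝ | 0 < p.1 ∧ 0 < f p.1 - p.2} :=
  hu.comp (f := fun p : ℝ × ℝ => (f p.1 - p.2, p.1))
    (((hf.comp contDiffOn_fst fun _ hp => hp.1).sub contDiffOn_snd).prodMk contDiffOn_fst)
    fun _ hp => ⟨hp.2, hp.1⟩

theorem dsnd_eq_deriv {F : ℝ × ℝ → ℝ} {p : ℝ × ℝ} (h : DifferentiableAt ℝ F p) :
    dsnd F p = deriv (fun x => F (p.1, x)) p.2 :=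
  (h.hasFDerivAt.comp_hasDerivAt p.2
    ((hasDerivAt_const p.2 p.1).prodMk (hasDerivAt_id p.2))).deriv.symm

theorem dfst_eq_deriv {F : ℝ × ℝ → ℝ} {p : ℝ × ℝ} (h : DifferentiableAt ℝ F p) :
    dfst F p = deriv (fun x => F (x, p.2)) p.1 :=
  (h.hasFDerivAt.comp_hasDerivAt p.1
    ((hasDerivAt_id p.1).prodMk (hasDerivAt_const p.1 p.2))).deriv.symm

theorem dsnd_consumption (hf : ContDiffOn ℝ (⊤ : ℕ∞) f (Ioi 0))
    (hu : ContDiffOn ℝ (⊤ : ℕ∞) (fun p : ℝ × ℝ => u p.1 p.2) (Ioi 0 ×ˢ Ioi 0)) (m : ℝ)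
    {p : ℝ × ℝ} (hp : p ∈ {p : ℝ × ℝ | 0 < p.1 ∧ 0 < f p.1 - p.2}) :
    dsnd (fun p : ℝ × ℝ => m * u (f p.1 - p.2) p.1) p = -(m * pd1 u (f p.1 - p.2) p.1) := by
  have hO := isOpen_consumption_pos hf
  have hX := contDiffOn_consumption hf hu
  have hd := differentiableAt_of_contDiffOn_quadrant hu hp.2 hp.1
  rw [dsnd_eq_deriv (((hX.contDiffAt (hO.mem_nhds hp)).differentiableAt (by simp)).const_mul m),
    pd1_eq_fderiv hd]
  have h1 : HasDerivAt (fun x => (f p.1 - x, p.1)) ((-1 : ℝ), (0 : ℝ)) p.2 :=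
    ((hasDerivAt_id p.2).const_sub (f p.1)).prodMk (hasDerivAt_const _ _)
  have h2 := (hd.hasFDerivAt.comp_hasDerivAt p.2 h1).const_mul m
  refine h2.deriv.trans ?_
  have e : ((-1, 0) : ℝ × ℝ) = -(1, 0) := by simp
  rw [e, map_neg, mul_neg]

theorem dfst_consumption (hf : ContDiffOn ℝ (⊤ : ℕ∞) f (Ioi 0))
    (hu : ContDiffOn ℝ (⊤ : ℕ∞) (fun p : ℝ × ℝ => u p.1 p.2) (Ioi 0 ×ˢ Ioi 0)) (m : ℝ)
    {p : ℝ × ℝ} (hp : p ∈ {p : ℝ × ℝ | 0 < p.1 ∧ 0 < f p.1 - p.2}) :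
    dfst (fun p : ℝ × ℝ => m * u (f p.1 - p.2) p.1) p =
      m * (pd1 u (f p.1 - p.2) p.1 * deriv f p.1 + pd2 u (f p.1 - p.2) p.1) := by
  have hO := isOpen_consumption_pos hf
  have hX := contDiffOn_consumption hf hu
  have hd := differentiableAt_of_contDiffOn_quadrant hu hp.2 hp.1
  rw [dfst_eq_deriv (((hX.contDiffAt (hO.mem_nhds hp)).differentiableAt (by simp)).const_mul m),
    pd1_eq_fderiv hd, pd2_eq_fderiv hd]
  have hfd : HasDerivAt f (deriv f p.1) p.1 :=
    ((hf.contDiffAt (Ioi_mem_nhds hp.1)).differentiableAt (by simp)).hasDerivAt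
  have h1 : HasDerivAt (fun x => (f x - p.2, x)) (deriv f p.1, (1 : ℝ)) p.1 :=
    (hfd.sub_const p.2).prodMk (hasDerivAt_id _)
  have h2 := (HasFDerivAt.comp_hasDerivAt (f := fun x => (f x - p.2, x)) p.1
    hd.hasFDerivAt h1).const_mul m
  refine h2.deriv.trans ?_
  have e : ((deriv f p.1, 1) : ℝ × ℝ) = deriv f p.1 • (1, 0) + (0, 1) := by simp
  rw [e, map_add, map_smul, smul_eq_mul, mul_comm (deriv f p.1)]

theorem pd1_hasDerivAt {c k : ℝ} (h : pd11 u c k < 0) :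
    HasDerivAt (fun c => pd1 u c k) (pd11 u c k) c :=
  (differentiableAt_of_deriv_ne_zero (f := fun c => pd1 u c k) h.ne).hasDerivAt

end Utility

/-- Solvability of the boundary-value problem in the biexponential
case. If `ḡ_λ ≠ 0` near `k∞` and `f'(k∞) ≠ ḡ_λ(k∞)` then the system (35)–(36) with the
boundary conditions (37)–(38) has a solution near `k∞`, with `V` of class `C²` and `W`
of class `C¹`. -/
theorem stmt_10
    (f : ℝ → ℝ) (u U : ℝ → ℝ → ℝ) (δ₁ δ₂ lam : ℝ)
    (hδ : δ₂ < δ₁) (hδ₂ : 0 < δ₂) (hlam0 : 0 < lam) (hlam1 : lam < 1)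
    (a b : ℝ) (ha : a = (δ₁ + δ₂) / 2) (hb : b = (δ₁ - δ₂) / 2)
    (hf_conc : ConcaveOn ℝ (Set.Ici 0) f)
    (hf_cont : ContinuousOn f (Set.Ici 0))
    (hf_smooth : ContDiffOn ℝ (⊤ : ℕ∞) f (Set.Ioi 0))
    (hf_inada0 : Tendsto (deriv f) (nhdsWithin 0 (Set.Ioi 0)) atTop)
    (hf_inada1 : ∃ L ≤ (0:ℝ), Tendsto (deriv f) atTop (nhds L))
    (hu_smooth : ContDiffOn ℝ (⊤ : ℕ∞) (fun p : ℝ × ℝ => u p.1 p.2) (Set.Ioi 0 ×ˢ Set.Ioi 0))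
    (hU_smooth : ContDiffOn ℝ (⊤ : ℕ∞) (fun p : ℝ × ℝ => U p.1 p.2) (Set.Ioi 0 ×ˢ Set.Ioi 0))
    (hu_mono : ∀ k > (0:ℝ), StrictMonoOn (fun c => u c k) (Set.Ioi 0))
    (hU_mono : ∀ k > (0:ℝ), StrictMonoOn (fun c => U c k) (Set.Ioi 0))
    (hu11 : ∀ c > (0:ℝ), ∀ k > (0:ℝ), pd11 u c k < 0)
    (hU11 : ∀ c > (0:ℝ), ∀ k > (0:ℝ), pd11 U c k < 0)
    (φ : ℝ → ℝ → ℝ)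
    (hφ : ∀ k > (0:ℝ), ∀ x > (0:ℝ),
      0 < φ x k ∧ pd1 u (φ x k) k + (1 - lam) / lam * pd1 U (φ x k) k = x)
    (kinf : ℝ) (hkinf : 0 < kinf) (hfkinf : 0 < f kinf)
    (M : Set ℝ) (hM : M ∈ nhds kinf)
    (hgbar_ne : ∀ k ∈ M, gbar f u U lam δ₁ δ₂ k ≠ 0)
    (hne : deriv f kinf ≠ gbar f u U lam δ₁ δ₂ kinf) :
    ∃ N : Set ℝ, IsOpen N ∧ kinf ∈ N ∧
    ∃ V W : ℝ → ℝ,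
      ContDiffOn ℝ 2 V N ∧ ContDiffOn ℝ 1 W N ∧
      (∀ k ∈ N, Eq35 f u U φ lam a b V W k ∧ Eq36 f u U φ lam a b V W k) ∧
      V kinf = u (f kinf) kinf / δ₁ + (1 - lam) / (lam * δ₂) * U (f kinf) kinf ∧
      W kinf = u (f kinf) kinf / δ₁ - (1 - lam) / (lam * δ₂) * U (f kinf) kinf := by
  have hδ₁ : 0 < δ₁ := hδ₂.trans hδ
  set μ : ℝ := (1 - lam) / lam with hμ
  have hμ0 : 0 < μ := div_pos (by linarith) hlam0
  have hlμ : lam * μ = 1 - lam := by rw [hμ]; field_simp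
  set O : Set (ℝ × ℝ) := {p | 0 < p.1 ∧ 0 < f p.1 - p.2} with hOdef
  have hO : IsOpen O := isOpen_consumption_pos hf_smooth
  have hk₀ : (kinf, (0 : ℝ)) ∈ O := ⟨hkinf, by simpa using hfkinf⟩
  set X : ℝ × ℝ → ℝ := fun p => 1 * u (f p.1 - p.2) p.1 with hXdef
  set Y : ℝ × ℝ → ℝ := fun p => μ * U (f p.1 - p.2) p.1 with hYdef
  have hX : ContDiffOn ℝ (⊤ : ℕ∞) X O :=
    contDiffOn_const.mul (contDiffOn_consumption hf_smooth hu_smooth)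
  have hY : ContDiffOn ℝ (⊤ : ℕ∞) Y O :=
    contDiffOn_const.mul (contDiffOn_consumption hf_smooth hU_smooth)
  have hX2 : ∀ p ∈ O, dsnd X p = -(1 * pd1 u (f p.1 - p.2) p.1) := fun p hp =>
    dsnd_consumption hf_smooth hu_smooth 1 hp
  have hY2 : ∀ p ∈ O, dsnd Y p = -(μ * pd1 U (f p.1 - p.2) p.1) := fun p hp =>
    dsnd_consumption hf_smooth hU_smooth μ hp
  have hPeq : ∀ p ∈ O, -(dsnd X p + dsnd Y p) =
      pd1 u (f p.1 - p.2) p.1 + μ * pd1 U (f p.1 - p.2) p.1 := fun p hp => by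
    rw [hX2 p hp, hY2 p hp]; ring
  have sP : ContDiffOn ℝ (⊤ : ℕ∞) (fun p => -(dsnd X p + dsnd Y p)) O :=
    ((contDiffOn_dsnd hO hX).add (contDiffOn_dsnd hO hY)).neg
  have hPne : dsnd (fun p => -(dsnd X p + dsnd Y p)) (kinf, 0) ≠ 0 := by
    rw [dsnd_eq_deriv ((sP.contDiffAt (hO.mem_nhds hk₀)).differentiableAt (by simp))]
    have hu := hu11 _ hfkinf _ hkinf
    have hU := hU11 _ hfkinf _ hkinf
    have h0 : f kinf = f kinf - 0 := (sub_zero _).symm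
    have hc : HasDerivAt (fun x => f kinf - x) (-1) 0 := (hasDerivAt_id 0).const_sub (f kinf)
    have h1 := (h0 ▸ pd1_hasDerivAt hu).comp (0 : ℝ) hc
    have h2 := (h0 ▸ pd1_hasDerivAt hU).comp (0 : ℝ) hc
    have hev : (fun x => -(dsnd X (kinf, x) + dsnd Y (kinf, x))) =ᶠ[𝓝 0]
        fun x => pd1 u (f kinf - x) kinf + μ * pd1 U (f kinf - x) kinf := by
      have : ∀ᶠ x in 𝓝 (0 : ℝ), (kinf, x) ∈ O :=
        (Continuous.prodMk_right kinf).continuousAt.eventually_mem (hO.mem_nhds hk₀)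
      exact this.mono fun x hx => hPeq _ hx
    have h3 := ((h1.add (h2.const_mul μ)).congr_of_eventuallyEq hev).deriv
    dsimp only
    rw [h3]
    simp only [sub_zero]
    have := mul_neg_of_pos_of_neg hμ0 hU
    exact ne_of_gt (by linarith)
  have hu1 := pd1_pos hfkinf hkinf (hu_mono _ hkinf) hu11
  have hU1 := pd1_pos hfkinf hkinf (hU_mono _ hkinf) hU11
  have hτ : δ₁ * (-(dsnd X (kinf, 0) + dsnd Y (kinf, 0))) - dfst X (kinf, 0) -
      dfst Y (kinf, 0) + (δ₁ - δ₂) * dsnd Y (kinf, 0) ≠ 0 := by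
    have e1 : dfst X (kinf, 0) = _ := dfst_consumption hf_smooth hu_smooth 1 hk₀
    have e2 : dfst Y (kinf, 0) = _ := dfst_consumption hf_smooth hU_smooth μ hk₀
    rw [e1, e2, hX2 _ hk₀, hY2 _ hk₀]
    simp only [sub_zero]
    intro h
    apply hne
    have hD : 0 < lam * pd1 u (f kinf) kinf + (1 - lam) * pd1 U (f kinf) kinf :=
      add_pos (mul_pos hlam0 hu1) (mul_pos (by linarith) hU1)
    rw [gbar, ← sub_div, eq_div_iff hD.ne']
    rw [← hlμ]
    linear_combination (-lam) * h
  obtain ⟨N, hN, hkN, x, v, w, r, q, hx0, hx, hr, hq, H⟩ := exists_value_pair hO hk₀ hX hY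
    hδ₁.ne' hδ₂.ne' (sub_pos.2 hδ).ne' hPne hτ
  have dV : ∀ k ∈ N, HasDerivAt (fun k => v k + w k) (r k + q k) k := fun k hk =>
    (H k hk).2.1.add (H k hk).2.2.1
  have dW : ∀ k ∈ N, HasDerivAt (fun k => v k - w k) (r k - q k) k := fun k hk =>
    (H k hk).2.1.sub (H k hk).2.2.1
  refine ⟨N, hN, hkN, fun k => v k + w k, fun k => v k - w k, ?_, ?_, fun k hk => ?_, ?_, ?_⟩
  · rw [show (2 : WithTop ℕ∞) = 1 + 1 by norm_num, contDiffOn_succ_iff_deriv_of_isOpen hN]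
    refine ⟨fun k hk => (dV k hk).differentiableAt.differentiableWithinAt, by simp, ?_⟩
    refine ContDiffOn.congr (f := fun k => -(dsnd X (k, x k) + dsnd Y (k, x k))) ?_
      fun k hk => (dV k hk).deriv.trans (H k hk).2.2.2.1
    exact (sP.of_le (by exact_mod_cast le_top)).comp (f := fun k => (k, x k))
      (contDiffOn_id.prodMk hx) fun k hk => (H k hk).1
  · rw [← zero_add (1 : WithTop ℕ∞), contDiffOn_succ_iff_deriv_of_isOpen hN]
    refine ⟨fun k hk => (dW k hk).differentiableAt.differentiableWithinAt, by simp, ?_⟩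
    rw [contDiffOn_zero]
    exact (hr.sub hq).congr fun k hk => (dW k hk).deriv
  · obtain ⟨hkO, -, -, hrq, hv, hw⟩ := H k hk
    have hP := hrq.trans (hPeq _ hkO)
    obtain ⟨hk0, hc0⟩ := hkO
    dsimp only at hk0 hc0 hP
    have hpos : 0 < r k + q k := by
      rw [hP]
      exact add_pos (pd1_pos hc0 hk0 (hu_mono _ hk0) hu11)
        (mul_pos hμ0 (pd1_pos hc0 hk0 (hU_mono _ hk0) hU11))
    obtain ⟨hφ0, hφe⟩ := hφ k hk0 _ hpos
    have hanti : StrictAntiOn (fun c => pd1 u c k + μ * pd1 U c k) (Ioi 0) :=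
      fun c hc d hd hcd => add_lt_add (pd1_strictAntiOn hk0 hu11 hc hd hcd)
        (mul_lt_mul_of_pos_left (pd1_strictAntiOn hk0 hU11 hc hd hcd) hμ0)
    have hφk : φ (r k + q k) k = f k - x k := hanti.injOn hφ0 hc0 (hφe.trans hP)
    simp only [hXdef, hYdef] at hv hw
    simp only [Eq35, Eq36, (dV k hk).deriv, (dW k hk).deriv, hφk, ← hμ]
    subst ha hb
    constructor
    · linear_combination hv + hw
    · linear_combination hv - hw
  all_goals
    obtain ⟨-, -, -, -, hv, hw⟩ := H kinf hkN
    simp only [hXdef, hYdef, hx0, zero_mul, zero_add, sub_zero, one_mul] at hv hw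
    have e : (1 - lam) / (lam * δ₂) = μ / δ₂ := by rw [hμ]; field_simp
    rw [e]
    dsimp only
    rw [hv, div_mul_eq_mul_div, hw]
    field_simp
end

section
/- (Sign of ḡ_λ − g̲_λ) For every k with u₁′(f(k),k) > 0 and U₁′(f(k),k) > 0, one has the identity ḡ_λ(k) − g̲_λ(k) = λ(1−λ)(δ₁−δ₂)·[(δ₁−δ₂)·u₁′·U₁′ − u₂′·U₁′ + u₁′·U₂′] / [(λu₁′+(1−λ)U₁′)·(λδ₂u₁′+(1−λ)δ₁U₁′)], all partial derivatives evaluated at (f(k),k). In particular, if δ₁−δ₂ > u₂′/u₁′ − U₂′/U₁′ then ḡ_λ(k) > g̲_λ(k), and if δ₁−δ₂ < u₂′/u₁′ − U₂′/U₁′ then ḡ_λ(k) < g̲_λ(k). -/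
open Filter Set

/-- `g̲_λ(k)`. -/
noncomputable def gunder (f : ℝ → ℝ) (u U : ℝ → ℝ → ℝ) (lam δ₁ δ₂ : ℝ) (k : ℝ) : ℝ :=
  (lam * pd1 u (f k) k + (1 - lam) * pd1 U (f k) k) /
    (lam / δ₁ * pd1 u (f k) k + (1 - lam) / δ₂ * pd1 U (f k) k) -
  (lam * δ₂ * pd2 u (f k) k + (1 - lam) * δ₁ * pd2 U (f k) k) /
    (lam * δ₂ * pd1 u (f k) k + (1 - lam) * δ₁ * pd1 U (f k) k)

/-- The difference of the two weighted averages, over a common denominator. -/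
theorem weighted_average_sub_eq {l d₁ d₂ a A b B : ℝ} (hd₁ : 0 < d₁) (hd₂ : 0 < d₂)
    (hl0 : 0 < l) (hl1 : l < 1) (ha : 0 < a) (hA : 0 < A) :
    ((l * d₁ * a + (1 - l) * d₂ * A) / (l * a + (1 - l) * A) -
        (l * b + (1 - l) * B) / (l * a + (1 - l) * A)) -
      ((l * a + (1 - l) * A) / (l / d₁ * a + (1 - l) / d₂ * A) -
        (l * d₂ * b + (1 - l) * d₁ * B) / (l * d₂ * a + (1 - l) * d₁ * A)) =
      l * (1 - l) * (d₁ - d₂) * ((d₁ - d₂) * a * A - b * A + a * B) /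
        ((l * a + (1 - l) * A) * (l * d₂ * a + (1 - l) * d₁ * A)) := by
  have hm : 0 < 1 - l := sub_pos.2 hl1
  have hP : l * a + (1 - l) * A ≠ 0 := by positivity
  have hQ : l * d₂ * a + (1 - l) * d₁ * A ≠ 0 := by positivity
  have hR : l / d₁ * a + (1 - l) / d₂ * A =
      (l * d₂ * a + (1 - l) * d₁ * A) / (d₁ * d₂) := by
    field_simp
  rw [hR, div_div_eq_mul_div, ← sub_div, ← sub_div,
    div_sub_div _ _ hP hQ]
  congr 1
  ring

/-- Sign of `ḡ_λ − g̲_λ`. -/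
theorem stmt_12
    (f : ℝ → ℝ) (u U : ℝ → ℝ → ℝ) (δ₁ δ₂ lam : ℝ)
    (hδ : δ₂ < δ₁) (hδ₂ : 0 < δ₂) (hlam0 : 0 < lam) (hlam1 : lam < 1)
    (hu_smooth : ContDiffOn ℝ (⊤ : ℕ∞) (fun p : ℝ × ℝ => u p.1 p.2) (Set.Ioi 0 ×ˢ Set.Ioi 0))
    (hU_smooth : ContDiffOn ℝ (⊤ : ℕ∞) (fun p : ℝ × ℝ => U p.1 p.2) (Set.Ioi 0 ×ˢ Set.Ioi 0)) :
    ∀ k : ℝ, 0 < pd1 u (f k) k → 0 < pd1 U (f k) k →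
      (gbar f u U lam δ₁ δ₂ k - gunder f u U lam δ₁ δ₂ k =
        lam * (1 - lam) * (δ₁ - δ₂) *
          ((δ₁ - δ₂) * pd1 u (f k) k * pd1 U (f k) k -
            pd2 u (f k) k * pd1 U (f k) k + pd1 u (f k) k * pd2 U (f k) k) /
        ((lam * pd1 u (f k) k + (1 - lam) * pd1 U (f k) k) *
          (lam * δ₂ * pd1 u (f k) k + (1 - lam) * δ₁ * pd1 U (f k) k))) ∧
      (δ₁ - δ₂ > pd2 u (f k) k / pd1 u (f k) k - pd2 U (f k) k / pd1 U (f k) k →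
        gbar f u U lam δ₁ δ₂ k > gunder f u U lam δ₁ δ₂ k) ∧
      (δ₁ - δ₂ < pd2 u (f k) k / pd1 u (f k) k - pd2 U (f k) k / pd1 U (f k) k →
        gbar f u U lam δ₁ δ₂ k < gunder f u U lam δ₁ δ₂ k) := by
  intro k ha hA
  have hd₁ : 0 < δ₁ := hδ₂.trans hδ
  have hm : 0 < 1 - lam := sub_pos.2 hlam1
  have hd : 0 < δ₁ - δ₂ := sub_pos.2 hδ
  have key := weighted_average_sub_eq (b := pd2 u (f k) k) (B := pd2 U (f k) k)
    hd₁ hδ₂ hlam0 hlam1 ha hA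
  simp only [gbar, gunder]
  set a := pd1 u (f k) k
  set A := pd1 U (f k) k
  set b := pd2 u (f k) k
  set B := pd2 U (f k) k
  have hnum : (δ₁ - δ₂) * a * A - b * A + a * B = a * A * (δ₁ - δ₂ - (b / a - B / A)) := by
    field_simp
    ring
  have haA : 0 < a * A := mul_pos ha hA
  have hc : 0 < lam * (1 - lam) * (δ₁ - δ₂) := by positivity
  have hden : 0 < (lam * a + (1 - lam) * A) * (lam * δ₂ * a + (1 - lam) * δ₁ * A) := by
    positivity
  refine ⟨key, fun h => ?_, fun h => ?_⟩
  · rw [gt_iff_lt, ← sub_pos, key, hnum]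
    exact div_pos (mul_pos hc (mul_pos haA (sub_pos.2 h))) hden
  · rw [← sub_neg, key, hnum]
    exact div_neg_of_neg_of_pos
      (mul_neg_of_pos_of_neg hc (mul_neg_of_pos_of_neg haA (sub_neg.2 h))) hden
end

section
/- (The Chichilnisky criterion cannot be optimized) Suppose u(c,k) ≥ 0 for all c>0, k>0, f is increasing with f(k)>0 for k>0, and sup{ U(c,k) : c>0, k>0, c=f(k) } = ∞. Then for any α > 0 and any k₀ > 0, sup{ I_α(c,k) : (c,k) ∈ A(k₀) and lim_{t→∞} U(c(t),k(t)) exists } = ∞; i.e., for every A ∈ ℝ there exists an admissible path (c,k) from k₀, with c piecewise constant, such that the limit lim_{t→∞} U(c(t),k(t)) exists and I_α(c,k) ≥ A. -/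
open MeasureTheory Filter Set

/-- A scalar autonomous ODE with continuous right-hand side bounded between two positive constants
has a monotone global solution through any two prescribed increasing values. -/
lemma exists_monotone_solution {G : ℝ → ℝ} {m M : ℝ} (hG : Continuous G) (hm : 0 < m)
    (hmG : ∀ x, m ≤ G x) (hGM : ∀ x, G x ≤ M) {a b : ℝ} (hab : a < b) :
    ∃ (y : ℝ → ℝ) (T : ℝ), 0 < T ∧ y 0 = a ∧ y T = b ∧ Monotone y ∧
      ∀ t, HasDerivAt y (G (y t)) t := by
  have hpos : ∀ x, 0 < G x := fun x => hm.trans_le (hmG x)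
  have hM : 0 < M := (hpos 0).trans_le (hGM 0)
  have hcont : Continuous fun x => (G x)⁻¹ := hG.inv₀ fun x => (hpos x).ne'
  let F : ℝ → ℝ := fun x => ∫ s in a..x, (G s)⁻¹
  have hF : ∀ x, HasDerivAt F (G x)⁻¹ x := fun x => hcont.integral_hasStrictDerivAt a x |>.hasDerivAt
  have hFa : F a = 0 := intervalIntegral.integral_same
  have hFmono : StrictMono F :=
    strictMono_of_deriv_pos fun x => by rw [(hF x).deriv]; exact inv_pos.2 (hpos x)
  have hFcont : Continuous F := continuous_iff_continuousAt.2 fun x => (hF x).continuousAt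
  have hdiff : Monotone fun x => F x - M⁻¹ * x := by
    have hd : ∀ x, HasDerivAt (fun x => F x - M⁻¹ * x) ((G x)⁻¹ - M⁻¹ * 1) x := fun x =>
      (hF x).sub ((hasDerivAt_id x).const_mul _)
    refine monotone_of_deriv_nonneg (fun x => (hd x).differentiableAt) fun x => ?_
    rw [(hd x).deriv, mul_one, sub_nonneg]
    exact inv_anti₀ (hpos x) (hGM x)
  have htop : Tendsto F atTop atTop := by
    have h1 : Tendsto (fun x : ℝ => M⁻¹ * x + (F 0 - M⁻¹ * 0)) atTop atTop :=
      tendsto_atTop_add_const_right _ _ (tendsto_id.const_mul_atTop (inv_pos.2 hM))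
    refine tendsto_atTop_mono' _ ?_ h1
    filter_upwards [eventually_ge_atTop 0] with x hx
    have := hdiff hx
    simp only at this
    linarith
  have hbot : Tendsto F atBot atBot := by
    have h1 : Tendsto (fun x : ℝ => M⁻¹ * x + (F 0 - M⁻¹ * 0)) atBot atBot :=
      tendsto_atBot_add_const_right _ _ (tendsto_id.const_mul_atBot (inv_pos.2 hM))
    refine tendsto_atBot_mono' _ ?_ h1
    filter_upwards [eventually_le_atBot 0] with x hx
    have := hdiff hx
    simp only at this
    linarith
  let e := hFmono.orderIsoOfSurjective F (hFcont.surjective htop hbot)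
  have heF : ∀ x, e x = F x := fun _ => rfl
  refine ⟨e.symm, F b, hFa ▸ hFmono hab, ?_, ?_, e.symm.monotone, fun t => ?_⟩
  · rw [← hFa, ← heF, e.symm_apply_apply]
  · rw [← heF, e.symm_apply_apply]
  · have := HasDerivAt.of_local_left_inverse (f := F) (g := e.symm) (a := t)
      e.symm.continuous.continuousAt (hF (e.symm t)) (inv_pos.2 (hpos _)).ne'
      (Eventually.of_forall fun s => e.apply_symm_apply s)
    rwa [inv_inv] at this

/-- With a suitable constant positive consumption, capital can be steered from any positive level
to any other positive level in finite time. -/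
lemma exists_constant_consumption_path {f : ℝ → ℝ} (hf_cont : ContinuousOn f (Ici 0))
    (hf_mono : MonotoneOn f (Ici 0)) (hf_pos : ∀ k > (0 : ℝ), 0 < f k)
    {a b : ℝ} (ha : 0 < a) (hb : 0 < b) :
    ∃ (c : ℝ) (y : ℝ → ℝ) (T : ℝ), 0 < c ∧ 0 < T ∧ y 0 = a ∧ y T = b ∧
      (∀ t ∈ Icc 0 T, 0 < y t) ∧ ∀ t ∈ Icc 0 T, HasDerivAt y (f (y t) - c) t := by
  have hclamp : ∀ {p q : ℝ} (hpq : p ≤ q), 0 < p →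
      Continuous (fun x => f (projIcc p q hpq x)) ∧
      ∀ x, f p ≤ f (projIcc p q hpq x) ∧ f (projIcc p q hpq x) ≤ f q := by
    intro p q hpq hp
    have hmem : ∀ x, (projIcc p q hpq x : ℝ) ∈ Icc p q := fun x => (projIcc p q hpq x).2
    have h0 : ∀ x, (projIcc p q hpq x : ℝ) ∈ Ici (0 : ℝ) := fun x => hp.le.trans (hmem x).1
    exact ⟨hf_cont.comp_continuous (continuous_subtype_val.comp continuous_projIcc) h0,
      fun x => ⟨hf_mono hp.le (h0 x) (hmem x).1, hf_mono (h0 x) (hp.le.trans hpq) (hmem x).2⟩⟩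
  rcases lt_trichotomy a b with hab | rfl | hab
  · obtain ⟨hc, hbd⟩ := hclamp hab.le ha
    obtain ⟨y, T, hT, hy0, hyT, hy, hd⟩ := exists_monotone_solution
      (G := fun x => f (projIcc a b hab.le x) - f a / 2) (m := f a / 2) (M := f b - f a / 2)
      (hc.sub continuous_const) (half_pos (hf_pos a ha)) (fun x => by linarith [(hbd x).1])
      (fun x => by linarith [(hbd x).2]) hab
    have hmem : ∀ t ∈ Icc 0 T, y t ∈ Icc a b := fun t ht =>
      ⟨hy0 ▸ hy ht.1, hyT ▸ hy ht.2⟩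
    refine ⟨f a / 2, y, T, half_pos (hf_pos a ha), hT, hy0, hyT,
      fun t ht => ha.trans_le (hmem t ht).1, fun t ht => ?_⟩
    have := hd t
    rwa [projIcc_of_mem _ (hmem t ht)] at this
  · exact ⟨f a, fun _ => a, 1, hf_pos a ha, one_pos, rfl, rfl, fun _ _ => ha, fun t _ => by
      simpa using hasDerivAt_const t a⟩
  · obtain ⟨hc, hbd⟩ := hclamp hab.le hb
    obtain ⟨y, T, hT, hy0, hyT, hy, hd⟩ := exists_monotone_solution
      (G := fun x => f a + 1 - f (projIcc b a hab.le x)) (m := 1) (M := f a + 1 - f b)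
      (continuous_const.sub hc) one_pos (fun x => by linarith [(hbd x).2])
      (fun x => by linarith [(hbd x).1]) hab
    have hmem : ∀ t ∈ Icc 0 T, y (T - t) ∈ Icc b a := fun t ht =>
      ⟨hy0 ▸ hy (by linarith [ht.2]), hyT ▸ hy (by linarith [ht.1])⟩
    refine ⟨f a + 1, fun t => y (T - t), T, by linarith [hf_pos a ha], hT, by simpa using hyT,
      by simpa using hy0, fun t ht => hb.trans_le (hmem t ht).1, fun t ht => ?_⟩
    have := (hd (T - t)).comp_const_sub T t
    rw [projIcc_of_mem _ (hmem t ht)] at this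
    simpa using this

/-- The Chichilnisky criterion cannot be optimized.
If `u ≥ 0`, `f` is increasing and positive on `(0,∞)`, and
`sup{U(c,k) : c>0, k>0, c=f(k)} = ∞`, then for every `A` there is an admissible path
from `k₀` with piecewise-constant consumption (constant before some time `T` and constant
after it) along which `lim_{t→∞} U(c(t),k(t))` exists and `I_α(c,k) ≥ A`;
hence the supremum of the Chichilnisky criterion is `+∞`. -/
theorem stmt_14
    (f : ℝ → ℝ) (u U : ℝ → ℝ → ℝ) (δ α : ℝ) (hδ : 0 < δ) (hα : 0 < α)
    (hf_conc : ConcaveOn ℝ (Set.Ici 0) f)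
    (hf_cont : ContinuousOn f (Set.Ici 0))
    (hf_smooth : ContDiffOn ℝ (⊤ : ℕ∞) f (Set.Ioi 0))
    (hf_inada0 : Tendsto (deriv f) (nhdsWithin 0 (Set.Ioi 0)) atTop)
    (hu_smooth : ContDiffOn ℝ (⊤ : ℕ∞) (fun p : ℝ × ℝ => u p.1 p.2) (Set.Ioi 0 ×ˢ Set.Ioi 0))
    (hU_smooth : ContDiffOn ℝ (⊤ : ℕ∞) (fun p : ℝ × ℝ => U p.1 p.2) (Set.Ioi 0 ×ˢ Set.Ioi 0))
    (hu_nonneg : ∀ c > (0:ℝ), ∀ k > (0:ℝ), 0 ≤ u c k)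
    (hf_mono : MonotoneOn f (Set.Ici 0))
    (hf_pos : ∀ k > (0:ℝ), 0 < f k)
    (hUsup : ∀ A : ℝ, ∃ k > (0:ℝ), A < U (f k) k)
    (k₀ : ℝ) (hk₀ : 0 < k₀) :
    ∀ A : ℝ, ∃ c k : ℝ → ℝ, ∃ T > (0:ℝ), ∃ L : ℝ,
      -- admissibility, with piecewise-constant consumption
      k 0 = k₀ ∧
      (∀ t : ℝ, 0 ≤ t → 0 < c t ∧ 0 < k t) ∧
      (∀ t ∈ Set.Ico (0:ℝ) T, c t = c 0) ∧
      (∀ t : ℝ, T ≤ t → c t = c T) ∧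
      ContinuousOn k (Set.Ici 0) ∧
      (∀ t : ℝ, 0 ≤ t → t ≠ T → HasDerivAt k (f (k t) - c t) t) ∧
      -- the limit in the Chichilnisky criterion exists
      Tendsto (fun t => U (c t) (k t)) atTop (nhds L) ∧
      IntegrableOn (fun t => u (c t) (k t) * Real.exp (-δ * t)) (Set.Ioi 0) ∧
      -- and the value of the criterion is at least A
      A ≤ δ * (∫ t in Set.Ioi (0:ℝ), u (c t) (k t) * Real.exp (-δ * t)) + α * L := by
  intro A
  obtain ⟨b, hb, hAb⟩ := hUsup (A / α)
  obtain ⟨c₁, y, T, hc₁, hT, hy0, hyT, hypos, hyd⟩ :=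
    exists_constant_consumption_path hf_cont hf_mono hf_pos hk₀ hb
  have hfb := hf_pos b hb
  set c : ℝ → ℝ := fun t => if t < T then c₁ else f b with hc
  set k : ℝ → ℝ := fun t => y (min t T) with hk
  have hclt : ∀ t, t < T → c t = c₁ := fun t ht => if_pos ht
  have hcge : ∀ t, T ≤ t → c t = f b := fun t ht => if_neg ht.not_gt
  have hklt : ∀ t, t < T → k t = y t := fun t ht => by simp only [hk, min_eq_left ht.le]
  have hkge : ∀ t, T ≤ t → k t = b := fun t ht => by simp only [hk, min_eq_right ht, hyT]
  have hmin : ∀ t, 0 ≤ t → min t T ∈ Icc 0 T := fun t ht => ⟨le_min ht hT.le, min_le_right _ _⟩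
  have hycont : ContinuousOn y (Icc 0 T) := fun t ht => (hyd t ht).continuousAt.continuousWithinAt
  have hckpos : ∀ t : ℝ, 0 ≤ t → 0 < c t ∧ 0 < k t := fun t ht =>
    ⟨by simp only [hc]; split_ifs <;> assumption, hypos _ (hmin t ht)⟩
  refine ⟨c, k, T, hT, U (f b) b, ?_, hckpos, ?_, ?_, ?_, ?_, ?_, ?_, ?_⟩
  · rw [hklt 0 hT, hy0]
  · intro t ht
    rw [hclt t ht.2, hclt 0 hT]
  · intro t ht
    rw [hcge t ht, hcge T le_rfl]
  · exact hycont.comp (by fun_prop) fun t ht => hmin t ht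
  · intro t ht0 htT
    rcases lt_or_gt_of_ne htT with h | h
    · rw [hklt t h, hclt t h]
      refine (hyd t ⟨ht0, h.le⟩).congr_of_eventuallyEq ?_
      filter_upwards [eventually_lt_nhds h] with s hs using hklt s hs
    · rw [hkge t h.le, hcge t h.le, sub_self]
      refine (hasDerivAt_const t b).congr_of_eventuallyEq ?_
      filter_upwards [eventually_gt_nhds h] with s hs using hkge s hs.le
  · refine tendsto_const_nhds.congr' ?_
    filter_upwards [eventually_ge_atTop T] with t ht
    rw [hcge t ht, hkge t ht]
  · rw [← Ioo_union_Ici_eq_Ioi hT]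
    refine IntegrableOn.union ?_ ?_
    · have hcont : ContinuousOn (fun t => u c₁ (y t) * Real.exp (-δ * t)) (Icc 0 T) := by
        refine ContinuousOn.mul ?_ (by fun_prop)
        exact hu_smooth.continuousOn.comp (continuousOn_const.prodMk hycont)
          fun t ht => ⟨hc₁, hypos t ht⟩
      refine (hcont.integrableOn_Icc.mono_set Ioo_subset_Icc_self).congr_fun ?_ measurableSet_Ioo
      intro t ht
      simp only [hclt t ht.2, hklt t ht.2]
    · have hexp : IntegrableOn (fun t => u (f b) b * Real.exp (-δ * t)) (Ici T) := by
        rw [integrableOn_Ici_iff_integrableOn_Ioi]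
        exact (exp_neg_integrableOn_Ioi T hδ).const_mul _
      refine hexp.congr_fun ?_ measurableSet_Ici
      intro t ht
      simp only [hcge t ht, hkge t ht]
  · have hint : 0 ≤ ∫ t in Ioi (0 : ℝ), u (c t) (k t) * Real.exp (-δ * t) :=
      setIntegral_nonneg measurableSet_Ioi fun t ht =>
        mul_nonneg (hu_nonneg _ (hckpos t (le_of_lt ht)).1 _ (hckpos t (le_of_lt ht)).2)
          (Real.exp_pos _).le
    have h1 := (div_lt_iff₀' hα).1 hAb
    have h2 := mul_nonneg hδ.le hint
    linarith
end
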